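/- There exists an absolute constant C such that for every odd prime p, all a, b ∈ (ℤ/pℤ)ˣ with ab ≠ 1, and all subgroups H, K of the multiplicative group (ℤ/pℤ)ˣ, the number f of pairs (t, y) ∈ H × K satisfying a·t + b·t⁻¹ = y + y⁻¹ satisfies |f − p·|H|·|K|/(p−1)²| ≤ C·√p. -/

import Mathlib

section

open Polynomial

/-- If `M` contains a primitive `d`-th root of unity and `a` is not an `r`-th power for any prime
`r ∣ d`, then `X ^ d - a` is irreducible. -/
theorem irreducible_X_pow_sub_C_of_isPrimitiveRoot {M : Type*} [Field M] {d : ℕ} (hd : 0 < d)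
    {ζ : M} (hζ : IsPrimitiveRoot ζ d) {a : M} (ha : a ≠ 0)
    (h : ∀ r : ℕ, r.Prime → r ∣ d → ∀ b : M, b ^ r ≠ a) :
    Irreducible (X ^ d - C a) := by
  let Ω := AlgebraicClosure M
  let φ := algebraMap M Ω
  obtain ⟨y, hy⟩ := IsAlgClosed.exists_pow_nat_eq (φ a) hd
  have hy0 : y ≠ 0 := by
    rintro rfl
    rw [zero_pow hd.ne', eq_comm, map_eq_zero] at hy
    exact ha hy
  have hmon : (X ^ d - C a).Monic := monic_X_pow_sub_C a hd.ne'
  have hint : IsIntegral M y := ⟨_, hmon, by simp [eval₂_sub, hy, φ]⟩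
  have hdvd : minpoly M y ∣ X ^ d - C a := minpoly.dvd _ _ (by simp [hy, φ])
  have hroot : ∀ z ∈ (minpoly M y).aroots Ω, ∃ c : M, z = φ c * y := by
    intro z hz
    have hz' : aeval z (X ^ d - C a) = 0 := by
      obtain ⟨q, hq⟩ := hdvd
      rw [hq, map_mul, (mem_aroots.1 hz).2, zero_mul]
    have hz2 : z ^ d = φ a := by simpa [sub_eq_zero] using hz'
    have h1 : (z / y) ^ d = 1 := by
      rw [div_pow, hz2, hy, div_self]
      simpa using ha
    have : NeZero d := ⟨hd.ne'⟩
    obtain ⟨i, -, hi⟩ := (hζ.map_of_injective φ.injective).eq_pow_of_pow_eq_one h1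
    exact ⟨ζ ^ i, by rw [map_pow, hi, div_mul_cancel₀ _ hy0]⟩
  have hprod : ∀ s : Multiset Ω, (∀ z ∈ s, ∃ c : M, z = φ c * y) →
      ∃ c : M, s.prod = φ c * y ^ s.card := by
    intro s
    induction s using Multiset.induction_on with
    | empty => exact fun _ => ⟨1, by simp⟩
    | cons z s ih =>
      intro hs
      obtain ⟨c, hc⟩ := ih fun w hw => hs w (Multiset.mem_cons_of_mem hw)
      obtain ⟨c', hc'⟩ := hs z (Multiset.mem_cons_self z s)
      exact ⟨c' * c, by rw [Multiset.prod_cons, Multiset.card_cons, hc, hc', map_mul]; ring⟩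
  set e := (minpoly M y).natDegree with he
  have hcard : ((minpoly M y).aroots Ω).card = e := by
    exact IsAlgClosed.card_aroots_eq_natDegree
  obtain ⟨c, hc⟩ := hprod _ hroot
  have hye : ∃ c : M, y ^ e = φ c := by
    have hsp := (IsAlgClosed.splits ((minpoly M y).map φ)).coeff_zero_eq_prod_roots_of_monic
      ((minpoly.monic hint).map φ)
    rw [show ((minpoly M y).map φ).roots = (minpoly M y).aroots Ω from rfl, hc, hcard,
      coeff_map] at hsp
    have hm0 : (minpoly M y).coeff 0 ≠ 0 := minpoly.coeff_zero_ne_zero hint hy0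
    have hc0 : φ c ≠ 0 := by
      intro h0
      rw [h0, zero_mul, mul_zero] at hsp
      exact hm0 (by simpa using hsp)
    rw [natDegree_map] at hsp
    refine ⟨(minpoly M y).coeff 0 / ((-1) ^ e * c), ?_⟩
    rw [map_div₀, hsp, map_mul, map_pow, map_neg, map_one, ← mul_assoc, mul_div_cancel_left₀]
    exact mul_ne_zero (pow_ne_zero _ (neg_ne_zero.2 one_ne_zero)) hc0
  have hle : e ≤ d := by
    have := natDegree_le_of_dvd hdvd hmon.ne_zero
    rwa [natDegree_X_pow_sub_C] at this
  have hepos : 0 < e := minpoly.natDegree_pos hint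
  rcases hle.eq_or_lt with hed | hed
  · have : minpoly M y = X ^ d - C a := by
      refine (eq_of_monic_of_dvd_of_natDegree_le (minpoly.monic hint) hmon hdvd ?_).symm
      rw [natDegree_X_pow_sub_C, ← hed]
    rw [← this]
    exact minpoly.irreducible hint
  exfalso
  obtain ⟨c, hc⟩ := hye
  have hg : ∃ b : M, y ^ (Nat.gcd e d) = φ b := by
    refine ⟨c ^ (Nat.gcdA e d) * a ^ (Nat.gcdB e d), ?_⟩
    rw [← zpow_natCast, Nat.gcd_eq_gcd_ab, zpow_add₀ hy0, zpow_mul, zpow_mul, zpow_natCast,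
      zpow_natCast, hc, hy]
    simp
  obtain ⟨b, hb⟩ := hg
  obtain ⟨k, hk⟩ := Nat.gcd_dvd_right e d
  have hk1 : k ≠ 1 := by
    rintro rfl
    have := Nat.le_of_dvd hepos (Nat.gcd_dvd_left e d)
    omega
  obtain ⟨r, hr, hrk⟩ := Nat.exists_prime_and_dvd hk1
  obtain ⟨l, rfl⟩ := hrk
  refine h r hr (hk ▸ ((Dvd.intro l rfl).mul_left _)) (b ^ l) ?_
  apply φ.injective
  rw [← pow_mul, map_pow, ← hb, ← pow_mul, mul_comm l r, ← hk, hy]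

theorem natDegree_det_le_of_natDegree_le {R : Type*} [CommRing R] {n : ℕ}
    (A : Matrix (Fin n) (Fin n) R[X]) (B : ℕ) (h : ∀ i j, (A i j).natDegree ≤ B) :
    A.det.natDegree ≤ n * B := by
  rw [Matrix.det_apply]
  refine natDegree_sum_le_of_forall_le _ _ fun σ _ => ?_
  refine (natDegree_smul_le _ _).trans ?_
  refine (natDegree_prod_le _ _).trans ?_
  refine (Finset.sum_le_card_nsmul _ _ B fun i _ => h _ _).trans ?_
  simp

theorem natDegree_resultant_le {R : Type*} [CommRing R] (f g : R[X][X]) (B : ℕ)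
    (hf : ∀ i, (f.coeff i).natDegree ≤ B) (hg : ∀ i, (g.coeff i).natDegree ≤ B) (m n : ℕ) :
    (resultant f g m n).natDegree ≤ (m + n) * B := by
  refine natDegree_det_le_of_natDegree_le _ B fun i j => ?_
  simp only [sylvester, Matrix.of_apply]
  refine j.addCases (fun j => ?_) (fun j => ?_)
  · simp only [Fin.addCases_left]
    split_ifs
    · exact hg _
    · simp
  · simp only [Fin.addCases_right]
    split_ifs
    · exact hf _
    · simp

/-- The substitution `G(U, X) ↦ G(X ^ r, X)` is injective on polynomials of degree less than `r`
in the outer variable. -/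
theorem eval₂_expand_ne_zero {K : Type*} [Field K] {r : ℕ} {R : K[X][X]}
    (hR : R ≠ 0) (hdeg : R.natDegree < r) :
    eval₂RingHom (expand K r : K[X] →+* K[X]) X R ≠ 0 := by
  have hr : 0 < r := by omega
  intro h0
  obtain ⟨i, hi⟩ : ∃ i, R.coeff i ≠ 0 := by
    by_contra! hc
    exact hR (ext hc)
  obtain ⟨j, hj⟩ : ∃ j, (R.coeff i).coeff j ≠ 0 := by
    by_contra! hc
    exact hi (ext hc)
  have hir : i < r := lt_of_le_of_lt (le_natDegree_of_ne_zero hi) hdeg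
  apply hj
  have := congrArg (fun P : K[X] => P.coeff (j * r + i)) h0
  simp only [coe_eval₂RingHom, eval₂_eq_sum_range, finsetSum_coeff, coeff_zero] at this
  rw [Finset.sum_eq_single i] at this
  · simpa [coeff_mul_X_pow, coeff_expand_mul hr] using this
  · intro b hb hbi
    have hbr : b < r := lt_of_le_of_lt (Nat.lt_succ_iff.1 (Finset.mem_range.1 hb)) hdeg
    rw [coeff_mul_X_pow']
    split_ifs with hle
    · simp only [RingHom.coe_coe]
      rw [coeff_expand hr, if_neg]
      intro hdiv
      apply hbi
      have h1 : j * r + i ≡ b [MOD r] := ((Nat.modEq_iff_dvd' hle).2 hdiv).symm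
      have h2 : i % r = b % r := by
        simpa [Nat.ModEq] using h1
      rwa [Nat.mod_eq_of_lt hir, Nat.mod_eq_of_lt hbr, eq_comm] at h2
    · rfl
  · intro hn
    exact absurd (Finset.mem_range.2 (Nat.lt_succ_of_le (le_natDegree_of_ne_zero hi))) hn

theorem pow_ne_of_forall_pow_ne {K : Type*} [Field K] {f : K[X]} {x₀ : K}
    (hx₀ : f.eval x₀ ≠ 0) {l : ℕ} (hl : 0 < l)
    (hf : ∀ (u : K) (g : K[X]), u ≠ 0 → g ^ l ≠ C u * f) (e : ℕ)
    (z : FractionRing K[X][X]) :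
    z ^ l ≠ algebraMap K[X][X] _ (f.map C ^ e * C f) := by
  intro hz
  obtain ⟨Q, rfl⟩ := IsIntegrallyClosed.exists_algebraMap_eq_of_isIntegral_pow (R := K[X][X]) hl
    (hz ▸ isIntegral_algebraMap)
  have hQ : Q ^ l = f.map C ^ e * C f :=
    IsFractionRing.injective K[X][X] (FractionRing K[X][X]) (by rw [map_pow, hz])
  refine hf (f.eval x₀ ^ e) (Q.eval (C x₀)) (pow_ne_zero _ hx₀) ?_
  rw [← eval_pow, hQ]
  simp [eval_map, eval₂_at_apply]

theorem stepanov_ne_zero {K : Type*} [Field K] {d r σ : ℕ} (hd : 0 < d) {ζ : K}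
    (hζ : IsPrimitiveRoot ζ d) (hσ : σ * d + 1 = r) {f : K[X]} (hexp : expand K r f = f ^ r)
    {x₀ : K} (hx₀ : f.eval x₀ ≠ 0)
    (hf : ∀ l : ℕ, l.Prime → l ∣ d → ∀ (u : K) (g : K[X]), u ≠ 0 → g ^ l ≠ C u * f)
    {b : Fin d → K[X][X]} {A : ℕ} (hb : ∀ j, (b j).natDegree ≤ A) (hne : b ≠ 0)
    (hlt : 2 * d * (A + d * f.natDegree) < r) :
    ∑ j, eval₂RingHom (expand K r : K[X] →+* K[X]) X (b j) * f ^ ((j : ℕ) * σ) ≠ 0 := by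
  intro h0
  set π := eval₂RingHom (expand K r : K[X] →+* K[X]) X with hπ
  have hf0 : f ≠ 0 := by rintro rfl; simp at hx₀
  have hfX0 : f.map C ≠ (0 : K[X][X]) := (Polynomial.map_ne_zero_iff C_injective).2 hf0
  have hfU0 : (C f : K[X][X]) ≠ 0 := C_ne_zero.2 hf0
  let M := FractionRing K[X][X]
  set F : K[X][X] := f.map C ^ (d - 1) * C f with hF
  have hF0 : F ≠ 0 := mul_ne_zero (pow_ne_zero _ hfX0) hfU0
  have hinj : Function.Injective (algebraMap K[X][X] M) := IsFractionRing.injective _ _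
  have hirr : Irreducible (X ^ d - C (algebraMap K[X][X] M F)) := by
    refine irreducible_X_pow_sub_C_of_isPrimitiveRoot hd
      (ζ := algebraMap K[X][X] M (C (C ζ))) ?_ ?_ ?_
    · exact ((hζ.map_of_injective C_injective).map_of_injective C_injective).map_of_injective hinj
    · exact (map_ne_zero_iff _ hinj).2 hF0
    · exact fun l hl hld z => pow_ne_of_forall_pow_ne hx₀ hl.pos (hf l hl hld) _ z
  set G : K[X][X][X] := ∑ j : Fin d, monomial (j : ℕ) (b j * f.map C ^ (d - 1 - j)) with hG
  set T : K[X][X][X] := X ^ d - C F with hT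
  have hTdeg : T.natDegree = d := natDegree_X_pow_sub_C
  have hGcoeff : ∀ j : Fin d, G.coeff j = b j * f.map C ^ (d - 1 - j) := by
    intro j
    rw [hG, finsetSum_coeff, Finset.sum_eq_single j]
    · simp
    · intro i _ hij
      rw [coeff_monomial, if_neg]
      exact fun h => hij (Fin.ext h)
    · simp
  have hGdeg : G.natDegree ≤ d - 1 := by
    refine natDegree_sum_le_of_forall_le _ _ fun j _ => ?_
    refine (natDegree_monomial_le _).trans ?_
    omega
  have hG0 : G ≠ 0 := by
    obtain ⟨j, hj⟩ := Function.ne_iff.1 hne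
    intro h
    have := hGcoeff j
    rw [h, coeff_zero] at this
    exact mul_ne_zero hj (pow_ne_zero _ hfX0) this.symm
  have hTmap : T.map (algebraMap K[X][X] M) = X ^ d - C (algebraMap K[X][X] M F) := by
    simp [hT]
  have hcop : IsCoprime (G.map (algebraMap K[X][X] M)) (T.map (algebraMap K[X][X] M)) := by
    rw [hTmap]
    refine ((Irreducible.coprime_iff_not_dvd hirr).2 fun hdvd => ?_).symm
    have h1 := natDegree_le_of_dvd hdvd ((Polynomial.map_ne_zero_iff hinj).2 hG0)
    rw [natDegree_X_pow_sub_C, natDegree_map_eq_of_injective hinj] at h1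
    omega
  set R := resultant G T G.natDegree d with hR
  have hR0 : R ≠ 0 := by
    intro h
    have h1 : resultant (G.map (algebraMap K[X][X] M)) (T.map (algebraMap K[X][X] M)) = 0 := by
      rw [natDegree_map_eq_of_injective hinj, natDegree_map_eq_of_injective hinj, hTdeg,
        resultant_map_map, ← hR, h, map_zero]
    exact (resultant_eq_zero_iff.1 h1).2 hcop
  have hfXdeg : ∀ e : ℕ, e ≤ d → (f.map C ^ e : K[X][X]).natDegree ≤ d * f.natDegree := by
    intro e he
    refine natDegree_pow_le.trans (Nat.mul_le_mul he natDegree_map_le)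
  have hRdeg : R.natDegree < r := by
    refine lt_of_le_of_lt (natDegree_resultant_le G T (A + d * f.natDegree) ?_ ?_ _ _) ?_
    · intro i
      by_cases hi : i < d
      · have := hGcoeff ⟨i, hi⟩
        simp only at this
        rw [this]
        refine natDegree_mul_le.trans (add_le_add (hb _) (hfXdeg _ ?_))
        omega
      · rw [coeff_eq_zero_of_natDegree_lt (by omega)]
        simp
    · intro i
      rw [hT, coeff_sub, coeff_X_pow, coeff_C]
      refine (natDegree_sub_le _ _).trans (max_le ?_ ?_)
      · split_ifs <;> simp
      · split_ifs
        · refine natDegree_mul_le.trans ?_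
          rw [natDegree_C, add_zero]
          exact (hfXdeg _ (by omega)).trans (by omega)
        · simp
    · refine lt_of_le_of_lt (Nat.mul_le_mul_right _ ?_) hlt
      omega
  refine eval₂_expand_ne_zero hR0 hRdeg ?_
  obtain ⟨u, v, -, -, huv⟩ := exists_mul_add_mul_eq_C_resultant (m := G.natDegree) (n := d) G T
    le_rfl hTdeg.le (Or.inr hd.ne')
  rw [← hR] at huv
  have hπX : π (f.map C) = f := by
    have : (expand K r : K[X] →+* K[X]).comp C = C := by ext; simp
    rw [hπ, coe_eval₂RingHom, eval₂_map, this, eval₂_C_X]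
  have hπU : π (C f) = f ^ r := by simp [hπ, hexp]
  have key := congrArg (eval₂RingHom π (f ^ (σ + 1))) huv
  have hGv : eval₂RingHom π (f ^ (σ + 1)) G = 0 := by
    rw [hG, map_sum]
    have : ∀ j : Fin d, eval₂RingHom π (f ^ (σ + 1)) (monomial (j : ℕ) (b j * f.map C ^ (d - 1 - j)))
        = f ^ (d - 1) * (π (b j) * f ^ ((j : ℕ) * σ)) := by
      intro j
      simp only [coe_eval₂RingHom, eval₂_monomial, map_mul, map_pow, hπX]
      have : d - 1 = d - 1 - (j : ℕ) + j := by omega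
      conv_rhs => rw [this]
      ring
    simp_rw [this]
    rw [← Finset.mul_sum, h0, mul_zero]
  have hTv : eval₂RingHom π (f ^ (σ + 1)) T = 0 := by
    rw [hT, coe_eval₂RingHom, eval₂_sub, eval₂_X_pow, eval₂_C, hF, map_mul, map_pow, hπX, hπU,
      ← pow_mul, ← pow_add, sub_eq_zero]
    congr 1
    obtain ⟨k, rfl⟩ : ∃ k, d = k + 1 := ⟨d - 1, by omega⟩
    rw [← hσ]
    simp
    ring
  rw [map_add, map_mul, map_mul, hGv, hTv, zero_mul, zero_mul, add_zero] at key
  rw [coe_eval₂RingHom, eval₂_C] at key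
  exact key.symm

/-- Stepanov's method: the auxiliary polynomial vanishing on the set `{x | f x ^ (σ (r + 1)) = α}`. -/
theorem exists_stepanov_polynomial {K : Type*} [Field K] [Fintype K] {p s d r σ N A : ℕ}
    [Fact p.Prime] [CharP K p] (hr : r = p ^ s) (hK : Fintype.card K = r ^ 2) (hd : 0 < d)
    {ζ : K} (hζ : IsPrimitiveRoot ζ d) (hσ : σ * d + 1 = r) (hσ0 : 0 < σ) {f : K[X]}
    (hexp : expand K r f = f ^ r) {x₀ : K} (hx₀ : f.eval x₀ ≠ 0)
    (hf : ∀ l : ℕ, l.Prime → l ∣ d → ∀ (u : K) (g : K[X]), u ≠ 0 → g ^ l ≠ C u * f)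
    (hlt : 2 * d * (A + d * f.natDegree) < r)
    (hcount : A * r + N + r * f.natDegree < d * (N * A)) {α : K} (hα : α ≠ 0) :
    ∃ Ψ : K[X], Ψ ≠ 0 ∧ Ψ.natDegree ≤ A + N * r + r * f.natDegree ∧
      ∀ x : K, f.eval x ^ (σ * (r + 1)) = α → Ψ.eval x = 0 := by
  have : Fintype (degreeLT K (A * r + N + r * f.natDegree)) :=
    Fintype.ofEquiv _ (degreeLTEquiv K _).toEquiv.symm
  have hcardlt : Fintype.card (degreeLT K (A * r + N + r * f.natDegree)) <
      Fintype.card (Fin d → Fin N → Fin A → K) := by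
    rw [Fintype.card_congr (degreeLTEquiv K _).toEquiv]
    simp only [Fintype.card_pi, Finset.prod_const, Finset.card_univ, Fintype.card_fin, ← pow_mul]
    refine Nat.pow_lt_pow_right Fintype.one_lt_card ?_
    calc _ < _ := hcount
      _ = _ := by ring
  have hdσ : ∀ j : ℕ, j < d → j * σ ≤ r := by
    intro j hj
    have := Nat.mul_le_mul_right σ hj.le
    rw [mul_comm d] at this
    omega
  have hdeg : ∀ j : ℕ, j < d → (f ^ (j * σ)).natDegree ≤ r * f.natDegree := fun j hj =>
    natDegree_pow_le.trans (Nat.mul_le_mul_right _ (hdσ j hj))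
  let E : (Fin d → Fin N → Fin A → K) → K[X] := fun c => ∑ j : Fin d, ∑ k : Fin N, ∑ i : Fin A,
    monomial ((i : ℕ) * r + k) (α ^ (j : ℕ) * c j k i ^ r) * f ^ ((d - 1 - j) * σ)
  have hE : ∀ c, E c ∈ degreeLT K (A * r + N + r * f.natDegree) := by
    intro c
    refine Submodule.sum_mem _ fun j _ => Submodule.sum_mem _ fun k _ =>
      Submodule.sum_mem _ fun i _ => ?_
    rw [mem_degreeLT]
    refine lt_of_le_of_lt degree_le_natDegree ?_
    rw [Nat.cast_lt]
    refine lt_of_le_of_lt natDegree_mul_le ?_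
    have h1 := hdeg (d - 1 - j) (by omega)
    have h2 := natDegree_monomial_le (m := (i : ℕ) * r + k) (α ^ (j : ℕ) * c j k i ^ r)
    have h3 : (i : ℕ) * r ≤ A * r := Nat.mul_le_mul_right _ i.2.le
    have := k.2
    omega
  have hEsub : ∀ c c', E (c - c') = E c - E c' := by
    intro c c'
    simp only [E, ← Finset.sum_sub_distrib, ← sub_mul, ← map_sub, ← mul_sub, Pi.sub_apply]
    simp only [hr, sub_pow_char_pow]
  obtain ⟨c₁, c₂, hne, heq⟩ := Fintype.exists_ne_map_eq_of_card_lt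
    (fun c => (⟨E c, hE c⟩ : degreeLT K (A * r + N + r * f.natDegree))) hcardlt
  set c := c₁ - c₂ with hc
  have hc0 : c ≠ 0 := sub_ne_zero.2 hne
  have hEc : E c = 0 := by rw [hc, hEsub, sub_eq_zero]; exact congrArg Subtype.val heq
  let b : Fin d → K[X][X] := fun j => ∑ i : Fin A, monomial (i : ℕ)
    (∑ k : Fin N, monomial (k : ℕ) (c j k i))
  have hb : ∀ j, (b j).natDegree ≤ A := fun j => natDegree_sum_le_of_forall_le _ _ fun i _ =>
    (natDegree_monomial_le _).trans i.2.le
  have hb0 : b ≠ 0 := by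
    intro h
    apply hc0
    funext j k i
    have := congrArg (fun P : K[X][X] => (P.coeff i).coeff k) (congrFun h j)
    simp only [b, finsetSum_coeff, coeff_monomial, Pi.zero_apply, coeff_zero] at this
    rw [Finset.sum_eq_single i (fun i' _ hi => by
      rw [if_neg (fun h => hi (Fin.ext h)), coeff_zero]) (by simp), if_pos rfl,
      finsetSum_coeff, Finset.sum_eq_single k (fun k' _ hk => by
      rw [coeff_monomial, if_neg (fun h => hk (Fin.ext h))]) (by simp), coeff_monomial,
      if_pos rfl] at this
    exact this
  have hΨ : ∑ j, eval₂RingHom (expand K r : K[X] →+* K[X]) X (b j) * f ^ ((j : ℕ) * σ) =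
      ∑ j : Fin d, ∑ i : Fin A, ∑ k : Fin N,
        monomial ((k : ℕ) * r + i) (c j k i) * f ^ ((j : ℕ) * σ) := by
    refine Finset.sum_congr rfl fun j _ => ?_
    simp only [b, map_sum, Finset.sum_mul]
    refine Finset.sum_congr rfl fun i _ => ?_
    simp only [coe_eval₂RingHom, eval₂_monomial, RingHom.coe_coe, expand_monomial]
    refine Finset.sum_congr rfl fun k _ => ?_
    rw [monomial_mul_X_pow]
  refine ⟨_, stepanov_ne_zero hd hζ hσ hexp hx₀ hf hb hb0 hlt, ?_, ?_⟩
  · rw [hΨ]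
    refine natDegree_sum_le_of_forall_le _ _ fun j _ => natDegree_sum_le_of_forall_le _ _ fun i _ =>
      natDegree_sum_le_of_forall_le _ _ fun k _ => ?_
    refine natDegree_mul_le.trans ?_
    have h1 := hdeg j j.2
    have h2 := natDegree_monomial_le (m := (k : ℕ) * r + i) (c j k i)
    have h3 : (k : ℕ) * r ≤ N * r := Nat.mul_le_mul_right _ k.2.le
    have := i.2
    omega
  · intro x hx
    have hfx : f.eval x ≠ 0 := by
      intro h
      rw [h, zero_pow (by positivity)] at hx
      exact hα hx.symm
    have hxr : x ^ (r * r) = x := by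
      rw [← sq, ← hK, FiniteField.pow_card]
    rw [hΨ]
    have key : (∑ j : Fin d, ∑ i : Fin A, ∑ k : Fin N,
        monomial ((k : ℕ) * r + i) (c j k i) * f ^ ((j : ℕ) * σ)).eval x ^ r *
          f.eval x ^ ((d - 1) * σ) = (E c).eval x := by
      simp only [E, eval_finsetSum, eval_mul, eval_monomial, eval_pow]
      rw [hr, sum_pow_char_pow, Finset.sum_mul]
      refine Finset.sum_congr rfl fun j _ => ?_
      rw [sum_pow_char_pow, Finset.sum_mul, Finset.sum_comm]
      refine Finset.sum_congr rfl fun i _ => ?_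
      rw [sum_pow_char_pow, Finset.sum_mul]
      refine Finset.sum_congr rfl fun k _ => ?_
      rw [← hr]
      have e1 : (x ^ ((k : ℕ) * r + i)) ^ r = x ^ ((i : ℕ) * r + k) := by
        rw [← pow_mul, add_mul, mul_assoc, pow_add, mul_comm (k : ℕ), pow_mul, hxr, ← pow_add,
          add_comm]
      have e2 : (f.eval x ^ ((j : ℕ) * σ)) ^ r * f.eval x ^ ((d - 1) * σ) =
          α ^ (j : ℕ) * f.eval x ^ ((d - 1 - j) * σ) := by
        rw [← hx, ← pow_mul, ← pow_mul, ← pow_add, ← pow_add]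
        congr 1
        obtain ⟨l, hl⟩ : ∃ l, d - 1 = j + l := ⟨d - 1 - j, by omega⟩
        rw [hl, Nat.add_sub_cancel_left]
        ring
      rw [mul_pow, mul_pow, e1, mul_assoc, e2]
      ring
    rw [hEc, eval_zero, mul_eq_zero] at key
    exact eq_zero_of_pow_eq_zero (key.resolve_right (pow_ne_zero _ hfx))

theorem card_pow_eq_le {K : Type*} [Field K] [Fintype K] [DecidableEq K] {p s d r σ : ℕ}
    [Fact p.Prime] [CharP K p] (hr : r = p ^ s) (hK : Fintype.card K = r ^ 2) (hd : 0 < d)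
    {ζ : K} (hζ : IsPrimitiveRoot ζ d) (hσ : σ * d + 1 = r) {f : K[X]}
    (hexp : expand K r f = f ^ r) {x₀ : K} (hx₀ : f.eval x₀ ≠ 0)
    (hf : ∀ l : ℕ, l.Prime → l ∣ d → ∀ (u : K) (g : K[X]), u ≠ 0 → g ^ l ≠ C u * f)
    (hlarge : 8 * d * (d + 1) * (f.natDegree + 4) < r) {α : K} (hα : α ≠ 0) :
    d * (Finset.univ.filter fun x : K => f.eval x ^ (σ * (r + 1)) = α).card ≤
      r ^ 2 + (8 * d * (f.natDegree + 4) + d + d * f.natDegree + 1) * r := by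
  set m := f.natDegree with hm
  set B := 8 * d * (m + 4) with hB
  have hBr : B + d < r := by nlinarith
  have hσ0 : 0 < σ := by
    rcases Nat.eq_zero_or_pos σ with h | h
    · subst h; omega
    · exact h
  set A := r / (4 * d) with hA
  have hA1 : 4 * d * A ≤ r := Nat.mul_div_le r (4 * d)
  have hA2 : r < 4 * d * A + 4 * d := by
    have := Nat.lt_mul_div_succ r (show 0 < 4 * d by positivity)
    rw [mul_add, mul_one] at this
    exact this
  have hA3 : r ≤ 8 * d * A := by nlinarith
  set N := (r + B) / d + 1 with hN
  have hN1 : d * N ≤ r + B + d := by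
    rw [hN, mul_add, mul_one]
    exact Nat.add_le_add_right (Nat.mul_div_le _ _) _
  have hN2 : r + B < d * N := Nat.lt_mul_div_succ _ hd
  have hN3 : N ≤ 2 * r := by
    have : N ≤ d * N := Nat.le_mul_of_pos_left _ hd
    omega
  obtain ⟨Ψ, hΨ0, hΨdeg, hΨ⟩ := exists_stepanov_polynomial (N := N) (A := A) hr hK hd hζ hσ hσ0 hexp
    hx₀ hf (by rw [← hm]; nlinarith) (by
      rw [← hm]
      have h1 : (r + B) * A ≤ d * N * A := Nat.mul_le_mul_right _ hN2.le
      have h2 : (m + 4) * r ≤ B * A := by rw [hB]; nlinarith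
      nlinarith) hα
  have hcard : (Finset.univ.filter fun x : K => f.eval x ^ (σ * (r + 1)) = α).card ≤
      A + N * r + r * m := by
    refine le_trans (le_trans (Finset.card_le_card (t := Ψ.roots.toFinset) ?_)
      (Multiset.toFinset_card_le _)) ((card_roots' Ψ).trans hΨdeg)
    intro x hx
    rw [Multiset.mem_toFinset, mem_roots hΨ0]
    exact hΨ x (Finset.mem_filter.1 hx).2
  calc _ ≤ d * (A + N * r + r * m) := Nat.mul_le_mul_left _ hcard
    _ = d * A + d * N * r + d * m * r := by ring
    _ ≤ r + (r + B + d) * r + d * m * r := by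
      refine add_le_add (add_le_add ?_ (Nat.mul_le_mul_right _ hN1)) le_rfl
      nlinarith
    _ = _ := by ring

theorem exists_mulChar_forall_eq_pow (p : ℕ) [Fact p.Prime] :
    ∃ ω : MulChar (ZMod p) ℂ, ∀ χ : MulChar (ZMod p) ℂ, ∃ m : ℕ, χ = ω ^ m := by
  obtain ⟨e⟩ := MulChar.mulEquiv_units (ZMod p) ℂ
  obtain ⟨u, hu⟩ := IsCyclic.exists_generator (α := (ZMod p)ˣ)
  refine ⟨e.symm u, fun χ => ?_⟩
  obtain ⟨m, hm⟩ := mem_powers_iff_mem_zpowers.2 (hu (e χ))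
  refine ⟨m, e.injective ?_⟩
  rw [map_pow, e.apply_symm_apply]
  exact hm.symm

theorem mulChar_pow_card_sub_one {p : ℕ} [Fact p.Prime] (χ : MulChar (ZMod p) ℂ) :
    χ ^ (p - 1) = 1 := by
  ext u
  rw [MulChar.pow_apply_coe, ← map_pow, ← Units.val_pow_eq_pow_val, ZMod.units_pow_card_sub_one_eq_one]
  simp

theorem exists_mulChar_common_power {p : ℕ} [Fact p.Prime] {ι : Type*}
    (χ : ι → MulChar (ZMod p) ℂ) (hχ : ∃ i, χ i ≠ 1) :
    ∃ (ω : MulChar (ZMod p) ℂ) (g d : ℕ) (m : ι → ℕ), g * d = p - 1 ∧ ω ^ g ≠ 1 ∧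
      (∀ i, 0 < m i) ∧ (∀ i, χ i = ω ^ (g * m i)) ∧
      ∀ l : ℕ, l.Prime → l ∣ d → ∃ i, ¬ l ∣ m i := by
  classical
  obtain ⟨ω, hω⟩ := exists_mulChar_forall_eq_pow p
  have hp1 : 0 < p - 1 := Nat.sub_pos_of_lt (Fact.out : p.Prime).one_lt
  let P : ℕ → Prop := fun g => g ∣ p - 1 ∧ ∃ m : ι → ℕ, ∀ i, χ i = ω ^ (g * m i)
  have hP1 : P 1 := by
    choose m hm using fun i => hω (χ i)
    exact ⟨one_dvd _, m, fun i => by rw [one_mul]; exact hm i⟩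
  set g := Nat.findGreatest P (p - 1) with hg
  obtain ⟨⟨d, hd⟩, m, hm⟩ : P g := Nat.findGreatest_spec (P := P) (m := 1) hp1 hP1
  have hmax : ∀ g', P g' → g' ≤ g := fun g' h =>
    Nat.le_findGreatest (Nat.le_of_dvd hp1 h.1) h
  have hd0 : 0 < d := Nat.pos_of_ne_zero (by rintro rfl; omega)
  have hg0 : 0 < g := Nat.pos_of_ne_zero (by intro h; rw [h] at hd; omega)
  refine ⟨ω, g, d, fun i => m i + d, hd.symm, ?_, fun i => by positivity, fun i => ?_, ?_⟩
  · intro h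
    obtain ⟨i, hi⟩ := hχ
    exact hi (by rw [hm, pow_mul, h, one_pow])
  · rw [mul_add, ← hd, pow_add, mulChar_pow_card_sub_one, mul_one, hm]
  · rintro l hl ⟨d', rfl⟩
    by_contra! hcon
    have hlm : ∀ i, l ∣ m i := fun i =>
      (Nat.dvd_add_left (Dvd.intro _ rfl)).1 (hcon i)
    choose m' hm' using hlm
    have := hmax (g * l) ⟨⟨d', by rw [hd]; ring⟩, m', fun i => by rw [hm, hm']; ring_nf⟩
    nlinarith [hl.two_le]

theorem norm_mulChar_le_one {p : ℕ} [Fact p.Prime] (χ : MulChar (ZMod p) ℂ) (x : ZMod p) :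
    ‖χ x‖ ≤ 1 := by
  by_cases hx : x = 0
  · subst hx
    rw [MulChar.map_zero]
    simp
  · have h : χ x ^ (p - 1) = 1 := by
      rw [← map_pow, ZMod.pow_card_sub_one_eq_one hx, map_one]
    exact (Complex.norm_eq_one_of_pow_eq_one h
      (Nat.sub_pos_of_lt (Fact.out : p.Prime).one_lt).ne').le

theorem norm_mulChar_eq_one {p : ℕ} [Fact p.Prime] (χ : MulChar (ZMod p) ℂ) {x : ZMod p}
    (hx : x ≠ 0) : ‖χ x‖ = 1 := by
  have h : χ x ^ (p - 1) = 1 := by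
    rw [← map_pow, ZMod.pow_card_sub_one_eq_one hx, map_one]
  exact Complex.norm_eq_one_of_pow_eq_one h
    (Nat.sub_pos_of_lt (Fact.out : p.Prime).one_lt).ne'

theorem expand_map_algebraMap_zmod {p : ℕ} [Fact p.Prime] {L : Type*} [Field L] [Algebra (ZMod p) L]
    (f : (ZMod p)[X]) (s : ℕ) :
    expand L (p ^ s) (f.map (algebraMap (ZMod p) L)) = f.map (algebraMap (ZMod p) L) ^ p ^ s := by
  rw [← map_expand, ← Polynomial.map_pow]
  congr 1
  induction s with
  | zero => simp
  | succ s ih => rw [pow_succ, mul_comm, expand_mul, ih, map_pow, ZMod.expand_card, ← pow_mul]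

theorem prod_X_sub_C_pow_ne_pow {L ι : Type*} [Field L] [Fintype ι] {a : ι → L}
    (ha : Function.Injective a) {m : ι → ℕ} {l : ℕ} {i : ι} (hi : ¬ l ∣ m i)
    {u : L} (hu : u ≠ 0) (g : L[X]) :
    g ^ l ≠ C u * ∏ i, (X - C (a i)) ^ m i := by
  classical
  intro h
  apply hi
  have h1 := congrArg (fun f : L[X] => f.roots.count (a i)) h
  have h0 : ∏ i, (X - C (a i)) ^ m i ≠ 0 :=
    Finset.prod_ne_zero_iff.2 fun i _ => pow_ne_zero _ (X_sub_C_ne_zero _)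
  simp only [roots_pow, Multiset.count_nsmul, roots_C_mul _ hu, roots_prod _ _ h0,
    roots_X_sub_C, Multiset.count_bind] at h1
  refine ⟨g.roots.count (a i), ?_⟩
  rw [h1]
  change _ = ∑ j, _
  rw [Finset.sum_eq_single i]
  · simp
  · intro j _ hj
    simp [ha.ne hj.symm]
  · simp

theorem norm_sum_mulChar_norm_le {p : ℕ} [Fact p.Prime] {ι : Type*} [Fintype ι]
    {a : ι → ZMod p} (ha : Function.Injective a) [Nonempty ι] {ω : MulChar (ZMod p) ℂ} {g d : ℕ} {m : ι → ℕ}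
    (hgd : g * d = p - 1) (hω : ω ^ g ≠ 1) (hm : ∀ i, 0 < m i)
    (hl : ∀ l : ℕ, l.Prime → l ∣ d → ∃ i, ¬ l ∣ m i) {s : ℕ}
    (hs : 8 * d * (d + 1) * (∑ i, m i + 4) < p ^ s)
    {L : Type*} [Field L] [Fintype L] [Algebra (ZMod p) L] (hL : Fintype.card L = (p ^ s) ^ 2) :
    ‖∑ x : L, ∏ i, (ω ^ (g * m i)) (Algebra.norm (ZMod p) (x - algebraMap (ZMod p) L (a i)))‖ ≤
      ((8 * d * (∑ i, m i + 4) + d + d * ∑ i, m i + 1 + ∑ i, m i : ℕ) : ℝ) * p ^ s := by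
  classical
  have hp := (Fact.out : p.Prime)
  have hp1 : 0 < p - 1 := Nat.sub_pos_of_lt hp.one_lt
  have hd0 : 0 < d := Nat.pos_of_ne_zero (by rintro rfl; omega)
  have hg0 : 0 < g := Nat.pos_of_ne_zero (by rintro rfl; omega)
  have : CharP L p := charP_of_injective_algebraMap (algebraMap (ZMod p) L).injective p
  set r := p ^ s with hr
  have hr0 : 0 < r := pow_pos hp.pos s
  set φ := algebraMap (ZMod p) L with hφ
  set f0 : (ZMod p)[X] := ∏ i, (X - C (a i)) ^ m i with hf0
  set f : L[X] := ∏ i, (X - C (φ (a i))) ^ m i with hfdef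
  have hff0 : f = f0.map φ := by simp [hf0, hfdef, Polynomial.map_prod]
  have hdegf : f.natDegree = ∑ i, m i := by
    rw [hfdef, natDegree_prod _ _ fun i _ => pow_ne_zero _ (X_sub_C_ne_zero _)]
    simp
  have hfne : f ≠ 0 := Finset.prod_ne_zero_iff.2 fun i _ => pow_ne_zero _ (X_sub_C_ne_zero _)
  obtain ⟨k, hk⟩ : p - 1 ∣ r - 1 := by simpa using Nat.sub_dvd_pow_sub_pow p 1 s
  set σ := g * k with hσdef
  have hσ : σ * d + 1 = r := by
    have : σ * d = r - 1 := by rw [hk, ← hgd, hσdef]; ring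
    omega
  have hqd : (Nat.card L - 1) / (Nat.card (ZMod p) - 1) = k * (r + 1) := by
    rw [Nat.card_eq_fintype_card, Nat.card_eq_fintype_card, hL, ZMod.card]
    apply Nat.div_eq_of_eq_mul_right hp1
    rw [← mul_assoc, ← hk, mul_comm]
    simpa using Nat.sq_sub_sq r 1
  have ht : ∀ x : L, φ (Algebra.norm (ZMod p) (f.eval x) ^ g) = f.eval x ^ (σ * (r + 1)) := by
    intro x
    rw [map_pow, FiniteField.algebraMap_norm_eq_pow, hqd, ← pow_mul]
    congr 1
    rw [hσdef]; ring
  set t : L → ZMod p := fun x => Algebra.norm (ZMod p) (f.eval x) ^ g with htdef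
  have hsum : ∀ x : L, ∏ i, (ω ^ (g * m i)) (Algebra.norm (ZMod p) (x - φ (a i))) = ω (t x) := by
    intro x
    simp only [htdef, hfdef, eval_prod, map_prod, ← Finset.prod_pow, eval_pow, eval_sub, eval_X,
      eval_C, map_pow]
    refine Finset.prod_congr rfl fun i _ => ?_
    rw [MulChar.pow_apply' _ (Nat.mul_pos hg0 (hm i)).ne', ← pow_mul, mul_comm]
  simp only [hsum]
  have htd : ∀ x, t x ≠ 0 → t x ^ d = 1 := by
    intro x hx
    rw [htdef] at hx ⊢
    simp only
    rw [← pow_mul, hgd, ZMod.pow_card_sub_one_eq_one]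
    exact fun h => hx (by simp [h, hg0.ne'])
  have hd0' : ∀ v : ZMod p, v ^ d = 1 → v ≠ 0 := by
    rintro v hv rfl
    simp [hd0.ne'] at hv
  set V := Finset.univ.filter fun v : ZMod p => v ^ d = 1 with hV
  have hVcard : V.card ≤ d := by
    refine le_trans (Finset.card_le_card (t := (nthRoots d (1 : ZMod p)).toFinset) ?_)
      ((Multiset.toFinset_card_le _).trans (card_nthRoots d 1))
    intro v hv
    rw [Multiset.mem_toFinset, mem_nthRoots hd0]
    exact (Finset.mem_filter.1 hv).2
  obtain ⟨v₀, hv₀, hωv₀⟩ : ∃ v₀ : ZMod p, v₀ ^ d = 1 ∧ ω v₀ ≠ 1 := by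
    obtain ⟨u, hu⟩ := MulChar.ne_one_iff.1 hω
    refine ⟨u ^ g, ?_, ?_⟩
    · rw [← pow_mul, hgd, ZMod.pow_card_sub_one_eq_one u.ne_zero]
    · rwa [map_pow, ← MulChar.pow_apply_coe]
  have hVsum : ∑ v ∈ V, ω v = 0 := by
    have h1 : ∑ v ∈ V, ω (v₀ * v) = ∑ v ∈ V, ω v := by
      refine Finset.sum_bijective (fun v => v₀ * v)
        ((Equiv.mulLeft₀ v₀ (hd0' _ hv₀)).bijective) (fun v => ?_) fun v _ => rfl
      simp [hV, mul_pow, hv₀]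
    simp only [map_mul, ← Finset.mul_sum] at h1
    by_contra h
    exact hωv₀ ((mul_eq_right₀ h).1 h1)
  let M : ZMod p → ℕ := fun v => (Finset.univ.filter fun x : L => t x = v).card
  have hSM : ∑ x : L, ω (t x) = ∑ v ∈ V, (M v : ℂ) * ω v := by
    rw [← Finset.sum_fiberwise' Finset.univ t fun v => ω v]
    simp only [Finset.sum_const, nsmul_eq_mul]
    symm
    refine Finset.sum_subset (Finset.subset_univ _) fun v _ hv => ?_
    by_cases h0 : v = 0
    · rw [h0, MulChar.map_zero, mul_zero]
    · have : M v = 0 := by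
        refine Finset.card_eq_zero.2 (Finset.filter_eq_empty_iff.2 fun x _ hx => hv ?_)
        subst hx
        exact Finset.mem_filter.2 ⟨Finset.mem_univ _, htd x h0⟩
      rw [this]; simp
  have hMsum : r ^ 2 ≤ ∑ v ∈ V, M v + ∑ i, m i := by
    have h1 : (Finset.univ.filter fun x : L => t x ∈ V).card = ∑ v ∈ V, M v := by
      rw [Finset.card_eq_sum_card_fiberwise (f := t) (t := V) (fun x hx => by simpa using hx)]
      refine Finset.sum_congr rfl fun v hv => ?_
      congr 1
      ext x
      simp only [Finset.mem_filter, Finset.mem_univ, true_and, and_iff_right_iff_imp]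
      rintro rfl
      exact hv
    have h2 : (Finset.univ.filter fun x : L => ¬ t x ∈ V).card ≤ ∑ i, m i := by
      rw [← hdegf]
      refine le_trans (Finset.card_le_card (t := f.roots.toFinset) ?_)
        ((Multiset.toFinset_card_le _).trans (card_roots' f))
      intro x hx
      rw [Multiset.mem_toFinset, mem_roots hfne, IsRoot]
      by_contra h0
      refine (Finset.mem_filter.1 hx).2 (Finset.mem_filter.2 ⟨Finset.mem_univ _, htd x ?_⟩)
      exact pow_ne_zero _ (Algebra.norm_ne_zero_iff.2 h0)
    rw [← h1, ← hL, ← Finset.card_univ,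
      ← Finset.card_filter_add_card_filter_not (s := Finset.univ) fun x : L => t x ∈ V]
    omega
  obtain ⟨x₀, hx₀⟩ : ∃ x₀, f.eval x₀ ≠ 0 := by
    refine exists_eval_ne_zero_of_natDegree_lt_card f hfne ?_
    rw [Cardinal.mk_fintype, Nat.cast_lt, hdegf, hL]
    have h1 : ∑ i, m i + 4 ≤ 8 * d * (d + 1) * (∑ i, m i + 4) :=
      Nat.le_mul_of_pos_left _ (by positivity)
    nlinarith
  obtain ⟨ζ, hζ⟩ : ∃ ζ : L, IsPrimitiveRoot ζ d := by
    obtain ⟨u, hu⟩ := IsCyclic.exists_ofOrder_eq_natCard (α := (ZMod p)ˣ)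
    rw [Nat.card_eq_fintype_card, ZMod.card_units] at hu
    have h1 : IsPrimitiveRoot u (p - 1) := hu ▸ IsPrimitiveRoot.orderOf u
    have h2 := (IsPrimitiveRoot.coe_units_iff.2 h1).pow hp1 hgd.symm
    exact ⟨_, h2.map_of_injective φ.injective⟩
  have hMle : ∀ v ∈ V, d * M v ≤ r ^ 2 + (8 * d * (∑ i, m i + 4) + d + d * ∑ i, m i + 1) * r := by
    intro v hv
    have hv0 := hd0' v (Finset.mem_filter.1 hv).2
    have := card_pow_eq_le hr hL hd0 hζ hσ (f := f)
      (by rw [hff0]; exact expand_map_algebraMap_zmod f0 s) hx₀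
      (fun l hlp hld u g hu => by
        obtain ⟨i, hi⟩ := hl l hlp hld
        exact prod_X_sub_C_pow_ne_pow (φ.injective.comp ha) hi hu g)
      (by rwa [hdegf]) (α := φ v) (by simpa using hv0)
    rw [hdegf] at this
    convert this using 5 with x
    rw [← ht, φ.injective.eq_iff]
  generalize 8 * d * (∑ i, m i + 4) + d + d * ∑ i, m i + 1 = C1 at hMle ⊢
  set B : ℝ := ((r ^ 2 + C1 * r : ℕ) : ℝ) / d with hB
  have hdR : (0 : ℝ) < d := by exact_mod_cast hd0
  have hMB : ∀ v ∈ V, (M v : ℝ) ≤ B := by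
    intro v hv
    rw [hB, le_div_iff₀ hdR, mul_comm]
    exact_mod_cast hMle v hv
  have hB0 : 0 ≤ B := by positivity
  calc ‖∑ x : L, ω (t x)‖ = ‖∑ v ∈ V, ((M v : ℂ) - (B : ℂ)) * ω v‖ := by
        simp only [sub_mul, Finset.sum_sub_distrib, ← Finset.mul_sum, hVsum, mul_zero, sub_zero, hSM]
    _ ≤ ∑ v ∈ V, (B - M v) := by
        refine (norm_sum_le _ _).trans (Finset.sum_le_sum fun v hv => ?_)
        rw [norm_mul]
        refine (mul_le_of_le_one_right (norm_nonneg _) (norm_mulChar_le_one ω v)).trans ?_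
        rw [← Complex.ofReal_natCast, ← Complex.ofReal_sub, Complex.norm_real, Real.norm_eq_abs,
          abs_of_nonpos (sub_nonpos.2 (hMB v hv)), neg_sub]
    _ = V.card * B - ((∑ v ∈ V, M v : ℕ) : ℝ) := by
        rw [Finset.sum_sub_distrib]; simp
    _ ≤ d * B - ((r : ℝ) ^ 2 - (∑ i, m i : ℕ)) := by
        refine sub_le_sub (mul_le_mul_of_nonneg_right (by exact_mod_cast hVcard) hB0) ?_
        rw [sub_le_iff_le_add]
        exact_mod_cast hMsum
    _ = C1 * r + (∑ i, m i : ℕ) := by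
        rw [hB, mul_div_cancel₀ _ hdR.ne']
        push_cast
        ring
    _ ≤ ((C1 + ∑ i, m i : ℕ) : ℝ) * (p : ℝ) ^ s := by
        have : ((p : ℝ) ^ s) = (r : ℝ) := by rw [hr]; push_cast; rfl
        rw [this, Nat.cast_add, add_mul]
        refine add_le_add le_rfl (le_mul_of_one_le_right (Nat.cast_nonneg _) ?_)
        exact_mod_cast hr0

theorem exists_norm_sum_mulChar_norm_le {p : ℕ} [Fact p.Prime] {ι : Type*} [Fintype ι]
    {a : ι → ZMod p} (ha : Function.Injective a) {χ : ι → MulChar (ZMod p) ℂ}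
    (hχ : ∃ i, χ i ≠ 1) :
    ∃ B s₀ : ℕ, ∀ s ≥ s₀, ∀ (L : Type) [Field L] [Fintype L] [Algebra (ZMod p) L],
      Fintype.card L = (p ^ s) ^ 2 →
      ‖∑ x : L, ∏ i, χ i (Algebra.norm (ZMod p) (algebraMap (ZMod p) L (a i) - x))‖ ≤
        B * p ^ s := by
  obtain ⟨ω, g, d, m, hgd, hω, hm, hχω, hl⟩ := exists_mulChar_common_power χ hχ
  have : Nonempty ι := ⟨hχ.choose⟩
  refine ⟨8 * d * (∑ i, m i + 4) + d + d * ∑ i, m i + 1 + ∑ i, m i,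
    8 * d * (d + 1) * (∑ i, m i + 4), fun s hs L _ _ _ hL => ?_⟩
  refine le_trans (le_of_eq ?_) (norm_sum_mulChar_norm_le ha hgd hω hm hl
    (lt_of_le_of_lt hs (Nat.lt_pow_self (Fact.out : p.Prime).one_lt)) hL)
  have h1 : Algebra.norm (ZMod p) (-1 : L) ≠ 0 := Algebra.norm_ne_zero_iff.2 (by simp)
  have h2 : ∀ x : L, ∏ i, χ i (Algebra.norm (ZMod p) (algebraMap (ZMod p) L (a i) - x)) =
      (∏ i, χ i (Algebra.norm (ZMod p) (-1 : L))) *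
        ∏ i, (ω ^ (g * m i)) (Algebra.norm (ZMod p) (x - algebraMap (ZMod p) L (a i))) := by
    intro x
    rw [← Finset.prod_mul_distrib]
    refine Finset.prod_congr rfl fun i _ => ?_
    rw [← hχω, ← map_mul, ← map_mul, neg_one_mul, neg_sub]
  simp only [h2, ← Finset.mul_sum]
  rw [norm_mul, norm_prod, Finset.prod_eq_one fun i _ => norm_mulChar_eq_one _ h1, one_mul]

theorem norm_le_of_norm_sum_pow_le {k : ℕ} (z : Fin k → ℂ) {B R : ℝ} (hR : 0 < R) {n₀ : ℕ}
    (h : ∀ n ≥ n₀, ‖∑ i, z i ^ n‖ ≤ B * R ^ n) (i : Fin k) : ‖z i‖ ≤ R := by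
  classical
  set S := Finset.univ.image z with hS
  set Q := Lagrange.basis S id (z i) with hQ
  have hzi : z i ∈ S := Finset.mem_image_of_mem _ (Finset.mem_univ _)
  have hQi : Q.eval (z i) = 1 := Lagrange.eval_basis_self (v := id) Function.injective_id.injOn hzi
  have hQj : ∀ j, z j ≠ z i → Q.eval (z j) = 0 := fun j hj =>
    Lagrange.eval_basis_of_ne (v := id) hj.symm (Finset.mem_image_of_mem _ (Finset.mem_univ _))
  set c := (Finset.univ.filter fun j => z j = z i).card with hc
  have hc1 : 1 ≤ c := Finset.card_pos.2 ⟨i, by simp⟩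
  have hsum : ∀ n, ∑ j, z j ^ n * Q.eval (z j) = c * z i ^ n := by
    intro n
    rw [← Finset.sum_filter_add_sum_filter_not Finset.univ fun j => z j = z i]
    rw [Finset.sum_eq_zero (s := Finset.univ.filter fun j => ¬ z j = z i) fun j hj => by
      rw [hQj j (Finset.mem_filter.1 hj).2, mul_zero], add_zero]
    rw [Finset.sum_congr rfl fun j hj => by rw [(Finset.mem_filter.1 hj).2, hQi, mul_one]]
    simp [hc]
  have hsum' : ∀ n, ∑ j, z j ^ n * Q.eval (z j) =
      ∑ t ∈ Finset.range (Q.natDegree + 1), Q.coeff t * ∑ j, z j ^ (n + t) := by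
    intro n
    simp only [eval_eq_sum_range, Finset.mul_sum]
    rw [Finset.sum_comm]
    refine Finset.sum_congr rfl fun j _ => Finset.sum_congr rfl fun t _ => ?_
    rw [pow_add]; ring
  set B' := ∑ t ∈ Finset.range (Q.natDegree + 1), ‖Q.coeff t‖ * (B * R ^ t) with hB'
  have hbound : ∀ n ≥ n₀, ‖z i‖ ^ n ≤ B' * R ^ n := by
    intro n hn
    calc ‖z i‖ ^ n ≤ ‖(c : ℂ) * z i ^ n‖ := by
          rw [norm_mul, norm_pow, Complex.norm_natCast]
          exact le_mul_of_one_le_left (by positivity) (by exact_mod_cast hc1)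
      _ ≤ _ := by
          rw [← hsum, hsum', hB', Finset.sum_mul]
          refine (norm_sum_le _ _).trans (Finset.sum_le_sum fun t _ => ?_)
          rw [norm_mul, mul_assoc]
          refine mul_le_mul_of_nonneg_left ((h _ (by omega)).trans (le_of_eq ?_)) (norm_nonneg _)
          rw [pow_add]; ring
  by_contra! hlt
  have h1 : 1 < ‖z i‖ / R := (one_lt_div hR).2 hlt
  obtain ⟨n, hn⟩ := pow_unbounded_of_one_lt (max B' 0) h1
  have hn2 : B' < (‖z i‖ / R) ^ (max n n₀) := lt_of_le_of_lt (le_max_left _ _)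
    (hn.trans_le (pow_le_pow_right₀ h1.le (le_max_left _ _)))
  rw [div_pow, lt_div_iff₀ (by positivity)] at hn2
  exact absurd (hbound _ (le_max_right n n₀)) hn2.not_ge

theorem exists_eq_neg_sum_pow_of_newton {k : ℕ} {c S : ℕ → ℂ} (hc0 : c 0 = 1)
    (hc : ∀ n, k < n → c n = 0)
    (hnewton : ∀ n : ℕ, (n : ℂ) * c n = ∑ x ∈ Finset.HasAntidiagonal.antidiagonal n with x.1 < n, c x.1 * S x.2) :
    ∃ z : Fin k → ℂ, ∀ n, 0 < n → S n = -∑ i, z i ^ n := by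
  classical
  let P : ℂ[X] := ∑ i ∈ Finset.range (k + 1), monomial i (c (k - i))
  have hPcoeff : ∀ i ≤ k, P.coeff i = c (k - i) := by
    intro i hi
    simp only [P, finsetSum_coeff, coeff_monomial]
    rw [Finset.sum_ite_eq' , if_pos (Finset.mem_range.2 (by omega))]
  have hPdeg' : P.natDegree ≤ k := natDegree_sum_le_of_forall_le _ _ fun i hi =>
    (natDegree_monomial_le _).trans (by have := Finset.mem_range.1 hi; omega)
  have hPk : P.coeff k = 1 := by rw [hPcoeff k le_rfl, Nat.sub_self, hc0]
  have hPdeg : P.natDegree = k := natDegree_eq_of_le_of_coeff_ne_zero hPdeg' (by simp [hPk])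
  have hPlead : P.leadingCoeff = 1 := by rw [leadingCoeff, hPdeg, hPk]
  have hcard : P.roots.card = P.natDegree := (IsAlgClosed.splits P).natDegree_eq_card_roots.symm
  obtain ⟨l, hl⟩ : ∃ l : List ℂ, (l : Multiset ℂ) = P.roots := Quot.exists_rep P.roots
  have hlk : l.length = k := by rw [← Multiset.coe_card, hl, hcard, hPdeg]
  subst hlk
  let z : Fin l.length → ℂ := l.get
  have hz : Multiset.map z Finset.univ.val = P.roots := by
    rw [← hl]
    simp [z]
  let e : ℕ → ℂ := fun n => MvPolynomial.aeval z (MvPolynomial.esymm (Fin l.length) ℂ n)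
  have he : ∀ n, e n = P.roots.esymm n := fun n => by
    rw [← hz]; exact MvPolynomial.aeval_esymm_eq_multiset_esymm _ _ _ _
  have hce : ∀ n, c n = (-1) ^ n * e n := by
    intro n
    rcases le_or_gt n l.length with h | h
    · have := coeff_eq_esymm_roots_of_card hcard (k := l.length - n) (by omega)
      rw [hPcoeff _ (by omega), hPlead, one_mul, hPdeg, Nat.sub_sub_self h] at this
      rw [this, he]
    · rw [hc n h, he, Multiset.esymm, Multiset.powersetCard_eq_empty _ (by rw [hcard, hPdeg]; exact h)]
      simp
  refine ⟨z, fun n hn => ?_⟩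
  have hN : ∀ n : ℕ, (n : ℂ) * c n =
      ∑ x ∈ Finset.HasAntidiagonal.antidiagonal n with x.1 < n, c x.1 * -∑ i, z i ^ x.2 := by
    intro n
    have := congrArg (MvPolynomial.aeval z) (MvPolynomial.mul_esymm_eq_sum (Fin l.length) ℂ n)
    simp only [map_mul, map_sum, map_pow, map_neg, map_one, map_natCast] at this
    rw [hce, ← mul_assoc, mul_comm _ ((-1) ^ n), mul_assoc, show (n : ℂ) * e n = _ from this,
      ← mul_assoc, ← pow_add, ← add_assoc, ← two_mul, pow_succ, pow_mul]
    simp only [neg_one_sq, one_pow, one_mul, neg_mul, mul_neg, Finset.sum_neg_distrib, neg_inj]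
    refine Finset.sum_congr rfl fun x _ => ?_
    rw [hce]
    simp [MvPolynomial.psum, e]
  induction n using Nat.strong_induction_on with
  | _ n ih =>
    have h1 := (hnewton n).symm.trans (hN n)
    have hmem : (0, n) ∈ (Finset.HasAntidiagonal.antidiagonal n).filter fun x => x.1 < n := by
      simpa using hn
    rw [← Finset.add_sum_erase _ _ hmem, ← Finset.add_sum_erase _ _ hmem] at h1
    rw [Finset.sum_congr rfl (g := fun x : ℕ × ℕ => c x.1 * -∑ i, z i ^ x.2)] at h1
    · simpa [hc0] using h1
    · intro x hx
      simp only [Finset.mem_erase, Finset.mem_filter, Finset.HasAntidiagonal.mem_antidiagonal] at hx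
      have : x.2 ≠ n := fun h => hx.1 (Prod.ext (by omega) h)
      rw [ih x.2 (by omega) (by omega)]

theorem finite_setOf_monic_natDegree_eq (K : Type*) [Field K] [Finite K] (n : ℕ) :
    {F : K[X] | F.Monic ∧ F.natDegree = n}.Finite := by
  have : Finite (degreeLT K n) := Finite.of_equiv _ (degreeLTEquiv K n).toEquiv.symm
  exact Finite.of_equiv _ (monicEquivDegreeLT (R := K) n).symm

/-- The monic polynomials of degree `n` over a finite field. -/
noncomputable def monicsOfDegree (K : Type*) [Field K] [Finite K] (n : ℕ) : Finset K[X] :=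
  (finite_setOf_monic_natDegree_eq K n).toFinset

theorem mem_monicsOfDegree {K : Type*} [Field K] [Finite K] {n : ℕ} {F : K[X]} :
    F ∈ monicsOfDegree K n ↔ F.Monic ∧ F.natDegree = n := by
  simp [monicsOfDegree]

open Classical in
/-- The monic irreducible polynomials over a finite field whose degree divides `m`, for `m > 0`. -/
noncomputable def primesOfDegreeDvd (K : Type*) [Field K] [Finite K] (m : ℕ) : Finset K[X] :=
  (m.divisors.biUnion (monicsOfDegree K)).filter Irreducible

theorem mem_primesOfDegreeDvd {K : Type*} [Field K] [Finite K] {m : ℕ} {P : K[X]} :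
    P ∈ primesOfDegreeDvd K m ↔ P.Monic ∧ Irreducible P ∧ P.natDegree ∣ m ∧ m ≠ 0 := by
  simp only [primesOfDegreeDvd, Finset.mem_filter, Finset.mem_biUnion, Nat.mem_divisors,
    mem_monicsOfDegree]
  constructor
  · rintro ⟨⟨d, hd, h1, rfl⟩, h2⟩
    exact ⟨h1, h2, hd⟩
  · rintro ⟨h1, h2, h3⟩
    exact ⟨⟨_, h3, h1, rfl⟩, h2⟩

theorem monic_of_mem_normalizedFactors {K : Type*} [Field K] [DecidableEq K] {F P : K[X]}
    (h : P ∈ UniqueFactorizationMonoid.normalizedFactors F) : P.Monic := by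
  rw [← UniqueFactorizationMonoid.normalize_normalized_factor P h]
  exact monic_normalize (UniqueFactorizationMonoid.irreducible_of_normalized_factor P h).ne_zero

theorem pow_dvd_iff_le_count_normalizedFactors {K : Type*} [Field K] [DecidableEq K] [DecidableEq K[X]]
    {F P : K[X]} (hF : F ≠ 0) (hP : Irreducible P) (hPm : P.Monic) (j : ℕ) :
    P ^ j ∣ F ↔ j ≤ (UniqueFactorizationMonoid.normalizedFactors F).count P := by
  rw [pow_dvd_iff_le_emultiplicity,
    UniqueFactorizationMonoid.emultiplicity_eq_count_normalizedFactors hP hF,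
    hPm.normalize_eq_self, Nat.cast_le]

open Classical in
theorem sum_natDegree_primesOfDegreeDvd {K : Type*} [Field K] [Finite K] {F : K[X]}
    (hF : F.Monic) :
    ∑ x ∈ Finset.HasAntidiagonal.antidiagonal F.natDegree with x.1 < F.natDegree,
      ∑ P ∈ primesOfDegreeDvd K x.2 with P ^ (x.2 / P.natDegree) ∣ F, P.natDegree =
        F.natDegree := by
  have h1 : F.natDegree = ∑ P ∈ (UniqueFactorizationMonoid.normalizedFactors F).toFinset,
      ∑ j ∈ Finset.Icc 1 ((UniqueFactorizationMonoid.normalizedFactors F).count P),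
        P.natDegree := by
    conv_lhs => rw [← hF.normalize_eq_self,
      ← UniqueFactorizationMonoid.prod_normalizedFactors_eq hF.ne_zero,
      natDegree_multiset_prod_of_monic _ fun P hP => monic_of_mem_normalizedFactors hP,
      Finset.sum_multiset_map_count]
    simp
  conv_rhs => rw [h1]
  rw [Finset.sum_sigma', Finset.sum_sigma']
  refine Finset.sum_bij' (fun x _ => ⟨x.2, x.1.2 / x.2.natDegree⟩)
    (fun y _ => ⟨(F.natDegree - y.2 * y.1.natDegree, y.2 * y.1.natDegree), y.1⟩) ?_ ?_ ?_ ?_ ?_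
  · rintro ⟨⟨u, v⟩, P⟩ h
    simp only [Finset.mem_sigma, Finset.mem_filter, Finset.HasAntidiagonal.mem_antidiagonal,
      mem_primesOfDegreeDvd] at h
    obtain ⟨⟨huv, hlt⟩, ⟨hPm, hP, hdvd, hv⟩, hPF⟩ := h
    have hpos : 1 ≤ v / P.natDegree := Nat.div_pos (Nat.le_of_dvd (by omega) hdvd) hP.natDegree_pos
    have hcount := (pow_dvd_iff_le_count_normalizedFactors hF.ne_zero hP hPm _).1 hPF
    simp only [Finset.mem_sigma, Multiset.mem_toFinset, Finset.mem_Icc]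
    exact ⟨Multiset.count_pos.1 (by omega), hpos, hcount⟩
  · rintro ⟨P, j⟩ h
    simp only [Finset.mem_sigma, Multiset.mem_toFinset, Finset.mem_Icc] at h
    obtain ⟨hP, hj1, hj⟩ := h
    have hPm := monic_of_mem_normalizedFactors hP
    have hPi := UniqueFactorizationMonoid.irreducible_of_normalized_factor P hP
    have hPF := (pow_dvd_iff_le_count_normalizedFactors hF.ne_zero hPi hPm _).2 hj
    have hle := natDegree_le_of_dvd hPF hF.ne_zero
    rw [natDegree_pow] at hle
    have hpos : 0 < j * P.natDegree := Nat.mul_pos hj1 hPi.natDegree_pos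
    simp only [Finset.mem_sigma, Finset.mem_filter, Finset.HasAntidiagonal.mem_antidiagonal,
      mem_primesOfDegreeDvd]
    rw [Nat.mul_div_cancel _ hPi.natDegree_pos]
    exact ⟨⟨by omega, by omega⟩, ⟨hPm, hPi, Dvd.intro_left _ rfl, hpos.ne'⟩, hPF⟩
  · rintro ⟨⟨u, v⟩, P⟩ h
    simp only [Finset.mem_sigma, Finset.mem_filter, Finset.HasAntidiagonal.mem_antidiagonal,
      mem_primesOfDegreeDvd] at h
    obtain ⟨⟨huv, hlt⟩, ⟨hPm, hP, hdvd, hv⟩, hPF⟩ := h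
    simp only [Nat.div_mul_cancel hdvd]
    rw [← huv, Nat.add_sub_cancel]
  · rintro ⟨P, j⟩ h
    simp only [Finset.mem_sigma, Multiset.mem_toFinset, Finset.mem_Icc] at h
    simp only [Nat.mul_div_cancel _
      (UniqueFactorizationMonoid.irreducible_of_normalized_factor P h.1).natDegree_pos]
  · intros; rfl

theorem natCast_mul_sum_monicsOfDegree {K : Type*} [Field K] [Finite K] (ψ : K[X] →* ℂ) (n : ℕ) :
    (n : ℂ) * ∑ F ∈ monicsOfDegree K n, ψ F =
      ∑ x ∈ Finset.HasAntidiagonal.antidiagonal n with x.1 < n,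
        (∑ F ∈ monicsOfDegree K x.1, ψ F) *
          ∑ P ∈ primesOfDegreeDvd K x.2, (P.natDegree : ℂ) * ψ P ^ (x.2 / P.natDegree) := by
  classical
  have h1 : ∀ x ∈ (Finset.HasAntidiagonal.antidiagonal n).filter fun x : ℕ × ℕ => x.1 < n,
      ∀ P ∈ primesOfDegreeDvd K x.2,
        ∑ G ∈ monicsOfDegree K x.1, ψ G * ψ P ^ (x.2 / P.natDegree) =
          ∑ F ∈ monicsOfDegree K n, if P ^ (x.2 / P.natDegree) ∣ F then ψ F else 0 := by
    intro x hx P hP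
    rw [Finset.mem_filter, Finset.HasAntidiagonal.mem_antidiagonal] at hx
    obtain ⟨hPm, hPi, hdvd, hx0⟩ := mem_primesOfDegreeDvd.1 hP
    have hQm : (P ^ (x.2 / P.natDegree)).Monic := hPm.pow _
    have hQdeg : (P ^ (x.2 / P.natDegree)).natDegree = x.2 := by
      rw [natDegree_pow, Nat.div_mul_cancel hdvd]
    rw [← Finset.sum_filter]
    refine Finset.sum_bij (fun G _ => P ^ (x.2 / P.natDegree) * G) ?_ ?_ ?_ ?_
    · intro G hG
      rw [mem_monicsOfDegree] at hG
      rw [Finset.mem_filter, mem_monicsOfDegree]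
      refine ⟨⟨hQm.mul hG.1, ?_⟩, Dvd.intro _ rfl⟩
      rw [hQm.natDegree_mul hG.1, hQdeg, hG.2, add_comm, hx.1]
    · intro G _ G' _ h
      exact mul_left_cancel₀ hQm.ne_zero h
    · intro F hF
      rw [Finset.mem_filter, mem_monicsOfDegree] at hF
      obtain ⟨⟨hFm, hFd⟩, G, rfl⟩ := hF
      have hGm := hQm.of_mul_monic_left hFm
      refine ⟨G, mem_monicsOfDegree.2 ⟨hGm, ?_⟩, rfl⟩
      rw [hQm.natDegree_mul hGm, hQdeg] at hFd
      omega
    · intro G _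
      rw [map_mul, map_pow, mul_comm]
  calc (n : ℂ) * ∑ F ∈ monicsOfDegree K n, ψ F =
      ∑ F ∈ monicsOfDegree K n, ψ F *
        ((∑ x ∈ Finset.HasAntidiagonal.antidiagonal n with x.1 < n,
          ∑ P ∈ primesOfDegreeDvd K x.2 with P ^ (x.2 / P.natDegree) ∣ F, P.natDegree : ℕ) : ℂ) := by
        rw [Finset.mul_sum]
        refine Finset.sum_congr rfl fun F hF => ?_
        obtain ⟨hFm, rfl⟩ := mem_monicsOfDegree.1 hF
        rw [sum_natDegree_primesOfDegreeDvd hFm, mul_comm]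
    _ = _ := by
        push_cast
        simp only [Finset.mul_sum, Finset.sum_filter (s := primesOfDegreeDvd K _)]
        rw [Finset.sum_comm]
        refine Finset.sum_congr rfl fun x hx => ?_
        rw [Finset.sum_comm]
        refine Finset.sum_congr rfl fun P hP => ?_
        have := congrArg (fun y => (P.natDegree : ℂ) * y) (h1 x hx P hP)
        simp only [Finset.mul_sum] at this
        rw [Finset.sum_mul]
        refine Eq.trans ?_ (this.symm.trans ?_)
        · refine Finset.sum_congr rfl fun F _ => ?_
          split_ifs <;> simp [mul_comm]
        · refine Finset.sum_congr rfl fun F _ => ?_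
          ring

theorem norm_algebraMap_sub_eq_minpoly_eval_pow {K L : Type*} [Field K] [Field L] [Algebra K L]
    [FiniteDimensional K L] (a : K) (x : L) :
    Algebra.norm K (algebraMap K L a - x) =
      (minpoly K x).eval a ^ (Module.finrank K L / (minpoly K x).natDegree) := by
  have hx : IsIntegral K x := Algebra.IsIntegral.isIntegral x
  let pb := IntermediateField.adjoin.powerBasis hx
  have hgen : pb.gen = IntermediateField.AdjoinSimple.gen K x :=
    IntermediateField.adjoin.powerBasis_gen hx
  have h1 : algebraMap K L a - x =
      algebraMap (IntermediateField.adjoin K {x}) L (algebraMap K _ a - pb.gen) := by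
    rw [map_sub, hgen, IntermediateField.AdjoinSimple.algebraMap_gen]
    rfl
  have h2 : Algebra.norm K (algebraMap K _ a - pb.gen) = (minpoly K x).eval a := by
    rw [Algebra.norm_eq_matrix_det pb.basis, map_sub, AlgHom.commutes,
      ← IntermediateField.minpoly_gen K x, ← hgen, ← charpoly_leftMulMatrix, Matrix.eval_charpoly]
    rfl
  rw [h1, ← Algebra.norm_norm (S := IntermediateField.adjoin K {x}), Algebra.norm_algebraMap,
    map_pow, h2, ← IntermediateField.adjoin.finrank hx,
    ← Module.finrank_mul_finrank K (IntermediateField.adjoin K {x}) L,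
    Nat.mul_div_cancel_left _ Module.finrank_pos]

theorem sum_minpoly_eq_sum_primesOfDegreeDvd {K L : Type*} [Field K] [Finite K] [Field L] [Fintype L]
    [Algebra K L] (Φ : K[X] → ℂ) :
    ∑ x : L, Φ (minpoly K x) =
      ∑ P ∈ primesOfDegreeDvd K (Module.finrank K L), (P.natDegree : ℂ) * Φ P := by
  classical
  have : FiniteDimensional K L := Module.Finite.of_finite
  have hmem : ∀ x ∈ (Finset.univ : Finset L), minpoly K x ∈
      primesOfDegreeDvd K (Module.finrank K L) := fun x _ => by
    have hx : IsIntegral K x := Algebra.IsIntegral.isIntegral x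
    exact mem_primesOfDegreeDvd.2 ⟨minpoly.monic hx, minpoly.irreducible hx, minpoly.degree_dvd hx,
      Module.finrank_pos.ne'⟩
  rw [← Finset.sum_fiberwise_of_maps_to' hmem]
  refine Finset.sum_congr rfl fun P hP => ?_
  obtain ⟨hPm, hPi, hdvd, -⟩ := mem_primesOfDegreeDvd.1 hP
  rw [Finset.sum_const, nsmul_eq_mul]
  congr 2
  have hsplit : (P.map (algebraMap K L)).Splits := by
    rw [hPi.natDegree_dvd_iff_dvd_X_pow_card_pow_sub_X, ← Module.natCard_eq_pow_finrank] at hdvd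
    have hL : (X ^ Nat.card L - X : L[X]).Splits := by
      rw [Nat.card_eq_fintype_card]
      simpa using (FiniteField.isSplittingField_sub L K).splits
    refine Splits.of_dvd hL (FiniteField.X_pow_card_sub_X_ne_zero _ Finite.one_lt_card) ?_
    simpa using Polynomial.map_dvd (algebraMap K L) hdvd
  rw [← card_rootSet_eq_natDegree (PerfectField.separable_of_irreducible hPi) hsplit,
    ← Set.toFinset_card]
  congr 1
  ext x
  simp only [Finset.mem_filter, Finset.mem_univ, true_and, Set.mem_toFinset, mem_rootSet]
  constructor
  · rintro rfl
    exact ⟨hPi.ne_zero, minpoly.aeval K x⟩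
  · rintro ⟨-, h⟩
    exact (minpoly.eq_of_irreducible_of_monic hPi h hPm).symm

theorem sum_prod_mulChar_eval_eq_zero {K ι : Type*} [Field K] [Finite K] [Fintype ι]
    {a : ι → K} (ha : Function.Injective a) {χ : ι → MulChar K ℂ} (hχ : ∃ i, χ i ≠ 1) {n : ℕ}
    (hn : Fintype.card ι ≤ n) :
    ∑ F ∈ monicsOfDegree K n, ∏ i, χ i (F.eval (a i)) = 0 := by
  classical
  obtain ⟨i, hi⟩ := hχ
  obtain ⟨u, hu⟩ := MulChar.ne_one_iff.1 hi
  set l := Lagrange.basis Finset.univ a i with hl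
  have hli : l.eval (a i) = 1 := Lagrange.eval_basis_self ha.injOn (Finset.mem_univ i)
  have hlj : ∀ j, j ≠ i → l.eval (a j) = 0 := fun j hj =>
    Lagrange.eval_basis_of_ne hj.symm (Finset.mem_univ j)
  have hldeg : l.natDegree < n := by
    have h1 := Lagrange.degree_basis (v := a) ha.injOn (Finset.mem_univ i)
    have h2 := natDegree_eq_of_degree_eq_some h1
    rw [Finset.card_univ, ← hl] at h2
    have : 0 < Fintype.card ι := Fintype.card_pos_iff.2 ⟨i⟩
    omega
  let T : K → K[X] → K[X] := fun v F => F + C ((v - 1) * F.eval (a i)) * l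
  have hTdeg : ∀ (v : K) (F : K[X]), (C ((v - 1) * F.eval (a i)) * l).natDegree < n := fun v F =>
    (natDegree_C_mul_le _ _).trans_lt hldeg
  have hTmem : ∀ v, ∀ F ∈ monicsOfDegree K n, T v F ∈ monicsOfDegree K n := by
    intro v F hF
    rw [mem_monicsOfDegree] at hF ⊢
    have h1 : (C ((v - 1) * F.eval (a i)) * l).degree < F.degree := by
      rw [degree_eq_natDegree hF.1.ne_zero, hF.2]
      exact degree_le_natDegree.trans_lt (by exact_mod_cast hTdeg v F)
    exact ⟨hF.1.add_of_left h1, by rw [natDegree_add_eq_left_of_degree_lt h1, hF.2]⟩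
  have hTi : ∀ (v : K) (F : K[X]), (T v F).eval (a i) = v * F.eval (a i) := fun v F => by
    simp only [T, eval_add, eval_mul, eval_C, hli]; ring
  have hTj : ∀ (v : K) (F : K[X]) (j), j ≠ i → (T v F).eval (a j) = F.eval (a j) := fun v F j hj => by
    simp only [T, eval_add, eval_mul, eval_C, hlj j hj]; ring
  have hTT : ∀ (v w : K) (F : K[X]), v * w = 1 → T v (T w F) = F := by
    intro v w F hvw
    simp only [T]
    rw [show eval (a i) (F + C ((w - 1) * eval (a i) F) * l) = w * F.eval (a i) from hTi w F,
      add_assoc, ← add_mul, ← C_add,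
      show (w - 1) * eval (a i) F + (v - 1) * (w * eval (a i) F) = (v * w - 1) * eval (a i) F by
        ring, hvw]
    simp
  have key : ∑ F ∈ monicsOfDegree K n, ∏ j, χ j (F.eval (a j)) =
      χ i u * ∑ F ∈ monicsOfDegree K n, ∏ j, χ j (F.eval (a j)) := by
    rw [Finset.mul_sum]
    refine (Finset.sum_nbij' (T u) (T (u⁻¹ : Kˣ)) (hTmem _) (hTmem _) (fun F _ => hTT _ _ F (by simp))
      (fun F _ => hTT _ _ F (by simp)) fun F _ => ?_).symm
    rw [← Finset.mul_prod_erase _ _ (Finset.mem_univ i),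
      ← Finset.mul_prod_erase _ _ (Finset.mem_univ i), hTi, map_mul, mul_assoc]
    congr 2
    exact Finset.prod_congr rfl fun j hj => by rw [hTj _ _ _ (Finset.ne_of_mem_erase hj)]
  by_contra h
  exact hu ((mul_eq_right₀ h).1 key.symm)

/-- Weil's bound for a product of multiplicative characters at distinct points. -/
theorem norm_sum_prod_mulChar_sub_le {p : ℕ} [Fact p.Prime] {ι : Type*} [Fintype ι] {k : ℕ}
    (hk : Fintype.card ι = k + 1) {a : ι → ZMod p} (ha : Function.Injective a)
    {χ : ι → MulChar (ZMod p) ℂ} (hχ : ∃ i, χ i ≠ 1) :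
    ‖∑ x : ZMod p, ∏ i, χ i (a i - x)‖ ≤ k * Real.sqrt p := by
  classical
  have hp := (Fact.out : p.Prime)
  let ψ : (ZMod p)[X] →* ℂ :=
    { toFun := fun F => ∏ i, χ i (F.eval (a i))
      map_one' := by simp
      map_mul' := fun F G => by simp [Finset.prod_mul_distrib] }
  let S : ℕ → ℂ := fun m => ∑ P ∈ primesOfDegreeDvd (ZMod p) m,
    (P.natDegree : ℂ) * ψ P ^ (m / P.natDegree)
  have hS : ∀ (L : Type) [Field L] [Fintype L] [Algebra (ZMod p) L],
      ∑ x : L, ∏ i, χ i (Algebra.norm (ZMod p) (algebraMap (ZMod p) L (a i) - x)) =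
        S (Module.finrank (ZMod p) L) := by
    intro L _ _ _
    have : FiniteDimensional (ZMod p) L := Module.Finite.of_finite
    refine Eq.trans ?_ (sum_minpoly_eq_sum_primesOfDegreeDvd (L := L)
      fun P => ψ P ^ (Module.finrank (ZMod p) L / P.natDegree))
    refine Finset.sum_congr rfl fun x _ => ?_
    simp only [norm_algebraMap_sub_eq_minpoly_eval_pow, map_pow, Finset.prod_pow]
    rfl
  obtain ⟨z, hz⟩ := exists_eq_neg_sum_pow_of_newton (k := k)
    (c := fun n => ∑ F ∈ monicsOfDegree (ZMod p) n, ψ F) (S := S) (by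
      rw [show monicsOfDegree (ZMod p) 0 = {1} by
        ext F
        rw [mem_monicsOfDegree, Finset.mem_singleton]
        constructor
        · rintro ⟨h1, h2⟩
          exact h1.natDegree_eq_zero.1 h2
        · rintro rfl
          simp]
      simp)
    (fun n hn => sum_prod_mulChar_eval_eq_zero ha hχ (by omega))
    (fun n => natCast_mul_sum_monicsOfDegree ψ n)
  obtain ⟨B, s₀, hB⟩ := exists_norm_sum_mulChar_norm_le ha hχ
  have hzle : ∀ i, ‖z i‖ ≤ Real.sqrt p := by
    intro i
    have h := norm_le_of_norm_sum_pow_le (fun i => z i ^ 2) (B := B) (R := p)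
      (by exact_mod_cast hp.pos) (n₀ := s₀ + 1) (fun s hs => by
        let L := GaloisField p (2 * s)
        have : Fintype L := Fintype.ofFinite L
        have h1 := hB s (by omega) L (by
          rw [← Nat.card_eq_fintype_card, GaloisField.card p _ (by omega), ← pow_mul, mul_comm])
        rw [hS L, GaloisField.finrank p (by omega), hz _ (by omega), norm_neg] at h1
        simpa only [← pow_mul] using h1) i
    rw [norm_pow] at h
    exact Real.le_sqrt_of_sq_le h
  have h1 := hS (ZMod p)
  rw [Module.finrank_self, hz 1 one_pos] at h1
  simp only [Algebra.algebraMap_self, RingHom.id_apply, Algebra.norm_self, MonoidHom.id_apply, pow_one] at h1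
  rw [h1, norm_neg]
  refine (norm_sum_le _ _).trans ((Finset.sum_le_card_nsmul _ _ _ fun i _ => hzle i).trans ?_)
  simp

theorem sum_units_mulChar {p : ℕ} [Fact p.Prime] (θ : MulChar (ZMod p) ℂ) [Decidable (θ = 1)] :
    ∑ y : (ZMod p)ˣ, θ y = if θ = 1 then (p - 1 : ℂ) else 0 := by
  have h := sum_hom_units ((θ : ZMod p →* ℂ).comp (Units.coeHom (ZMod p)))
  have h1 : (θ : ZMod p →* ℂ).comp (Units.coeHom (ZMod p)) = 1 ↔ θ = 1 := by
    rw [MulChar.eq_one_iff, MonoidHom.ext_iff]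
    rfl
  rw [ZMod.card_units] at h
  have hp : ((p - 1 : ℕ) : ℂ) = p - 1 := by
    rw [Nat.cast_sub (Fact.out : p.Prime).one_le, Nat.cast_one]
  simp only [MonoidHom.comp_apply, Units.coeHom_apply, h1, apply_ite (Nat.cast : ℕ → ℂ), hp,
    Nat.cast_zero] at h
  exact h

theorem sum_mulChar_apply {p : ℕ} [Fact p.Prime] (z : ZMod p) :
    ∑ χ : MulChar (ZMod p) ℂ, χ z = if z = 1 then (p - 1 : ℂ) else 0 := by
  have h := DirichletCharacter.sum_characters_eq ℂ z
  rw [Nat.totient_prime Fact.out, Nat.cast_sub (Fact.out : p.Prime).one_le, Nat.cast_one] at h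
  exact h

theorem natCast_sub_one_ne_zero_of_prime (p : ℕ) [Fact p.Prime] : (p - 1 : ℂ) ≠ 0 := by
  rw [sub_ne_zero]
  exact_mod_cast (Fact.out : p.Prime).ne_one

theorem sum_units_sq_eq_mulChar {p : ℕ} [Fact p.Prime] (θ : MulChar (ZMod p) ℂ)
    [DecidableEq (MulChar (ZMod p) ℂ)] (g : ZMod p) :
    ∑ y : (ZMod p)ˣ, (if (y : ZMod p) ^ 2 = g then θ y else 0) =
      ∑ ρ : MulChar (ZMod p) ℂ, if ρ ^ 2 = θ then ρ g else 0 := by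
  refine mul_left_cancel₀ (natCast_sub_one_ne_zero_of_prime p) ?_
  rw [Finset.mul_sum, Finset.mul_sum]
  trans ∑ y : (ZMod p)ˣ, ∑ ρ : MulChar (ZMod p) ℂ, θ y * ρ (g * ((y : ZMod p) ^ 2)⁻¹)
  · refine Finset.sum_congr rfl fun y _ => ?_
    rw [← Finset.mul_sum, sum_mulChar_apply]
    have hy : (y : ZMod p) ^ 2 ≠ 0 := pow_ne_zero _ y.ne_zero
    have h : g * ((y : ZMod p) ^ 2)⁻¹ = 1 ↔ (y : ZMod p) ^ 2 = g := by
      rw [mul_inv_eq_one₀ hy, eq_comm]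
    simp only [h]
    split_ifs <;> ring
  · rw [Finset.sum_comm]
    refine Finset.sum_congr rfl fun ρ _ => ?_
    have h1 : ∀ y : (ZMod p)ˣ, θ y * ρ (g * ((y : ZMod p) ^ 2)⁻¹) = ρ g * (θ * (ρ ^ 2)⁻¹) y := by
      intro y
      rw [map_mul, MulChar.mul_apply, MulChar.inv_apply', MulChar.pow_apply' _ two_ne_zero,
        ← map_pow, inv_pow]
      ring
    simp only [h1]
    rw [← Finset.mul_sum, sum_units_mulChar]
    simp only [mul_inv_eq_one, eq_comm (a := θ)]
    split_ifs <;> ring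

theorem card_mulChar_sq_eq_le {p : ℕ} [Fact p.Prime] (θ : MulChar (ZMod p) ℂ)
    [DecidableEq (MulChar (ZMod p) ℂ)] :
    (Finset.univ.filter fun ρ : MulChar (ZMod p) ℂ => ρ ^ 2 = θ).card ≤ 2 := by
  obtain ⟨ω, hω⟩ := exists_mulChar_forall_eq_pow p
  have : IsCyclic (MulChar (ZMod p) ℂ) := ⟨ω, fun χ => by
    obtain ⟨m, rfl⟩ := hω χ
    exact ⟨m, zpow_natCast _ _⟩⟩
  rcases (Finset.univ.filter fun ρ : MulChar (ZMod p) ℂ => ρ ^ 2 = θ).eq_empty_or_nonempty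
    with h | ⟨ρ₀, h⟩
  · simp [h]
  · refine le_trans (Finset.card_le_card_of_injOn (fun ρ => ρ * ρ₀⁻¹) ?_ ?_)
      (IsCyclic.card_pow_eq_one_le (α := MulChar (ZMod p) ℂ) two_pos)
    · intro ρ hρ
      simp only [Finset.coe_filter, Finset.mem_univ, true_and, Set.mem_ofPred_eq,
        Finset.mem_filter] at hρ h ⊢
      rw [mul_pow, hρ, inv_pow, h, mul_inv_cancel]
    · exact fun _ _ _ _ h => mul_right_cancel h

/-- The Fourier coefficient at `χ` of the indicator function of a subgroup `H`. -/
noncomputable def subgroupWeight {p : ℕ} (H : Subgroup (ZMod p)ˣ) (χ : MulChar (ZMod p) ℂ) : ℝ :=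
  open scoped Classical in if ∀ h : H, χ (h : (ZMod p)ˣ) = 1 then Nat.card H / ((p : ℝ) - 1) else 0

theorem subgroupWeight_nonneg {p : ℕ} [Fact p.Prime] (H : Subgroup (ZMod p)ˣ)
    (χ : MulChar (ZMod p) ℂ) : 0 ≤ subgroupWeight H χ := by
  have : (1 : ℝ) ≤ p := by exact_mod_cast (Fact.out : p.Prime).one_le
  unfold subgroupWeight
  split_ifs
  · exact div_nonneg (Nat.cast_nonneg _) (by linarith)
  · exact le_rfl

theorem subgroupWeight_one {p : ℕ} (H : Subgroup (ZMod p)ˣ) :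
    subgroupWeight H 1 = Nat.card H / ((p : ℝ) - 1) :=
  if_pos fun _ => MulChar.one_apply_coe _

theorem mul_subgroupWeight {p : ℕ} [Fact p.Prime] (H : Subgroup (ZMod p)ˣ) [Fintype H]
    (χ : MulChar (ZMod p) ℂ) :
    (p - 1 : ℂ) * subgroupWeight H χ = ∑ h : H, χ (h : (ZMod p)ˣ) := by
  classical
  have h := sum_hom_units (((χ : ZMod p →* ℂ).comp (Units.coeHom (ZMod p))).comp H.subtype)
  have h1 : ((χ : ZMod p →* ℂ).comp (Units.coeHom (ZMod p))).comp H.subtype = 1 ↔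
      ∀ h : H, χ (h : (ZMod p)ˣ) = 1 := by
    rw [MonoidHom.ext_iff]
    rfl
  simp only [h1] at h
  refine Eq.trans ?_ h.symm
  have := natCast_sub_one_ne_zero_of_prime p
  unfold subgroupWeight
  split_ifs
  · push_cast
    rw [Nat.card_eq_fintype_card]
    field_simp
  · simp

theorem sum_subgroupWeight_mul {p : ℕ} [Fact p.Prime] (H : Subgroup (ZMod p)ˣ) (t : (ZMod p)ˣ)
    [Decidable (t ∈ H)] :
    ∑ χ : MulChar (ZMod p) ℂ, (subgroupWeight H χ : ℂ) * χ t = if t ∈ H then 1 else 0 := by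
  classical
  have : Fintype H := Fintype.ofFinite H
  refine mul_left_cancel₀ (natCast_sub_one_ne_zero_of_prime p) ?_
  rw [Finset.mul_sum]
  simp only [← mul_assoc, mul_subgroupWeight, Finset.sum_mul]
  rw [Finset.sum_comm]
  simp only [← map_mul, ← Units.val_mul, sum_mulChar_apply, Units.val_eq_one]
  split_ifs with h
  · rw [Finset.sum_eq_single ⟨t⁻¹, H.inv_mem h⟩]
    · simp
    · intro s _ hs
      rw [if_neg]
      exact fun h' => hs (Subtype.ext (eq_inv_of_mul_eq_one_left h'))
    · simp
  · rw [mul_zero]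
    refine Finset.sum_eq_zero fun s _ => if_neg fun h' => h ?_
    rw [eq_inv_of_mul_eq_one_right h']
    exact H.inv_mem s.2

theorem sum_subgroupWeight {p : ℕ} [Fact p.Prime] (H : Subgroup (ZMod p)ˣ) :
    ∑ χ : MulChar (ZMod p) ℂ, subgroupWeight H χ = 1 := by
  classical
  have h := sum_subgroupWeight_mul H 1
  simp only [Units.val_one, map_one, mul_one, H.one_mem, if_true] at h
  exact_mod_cast h

theorem norm_sum_mulChar_mul_mulChar_le {p : ℕ} [Fact p.Prime] {c : ZMod p} (hc0 : c ≠ 0)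
    (hc1 : c ≠ 1) {χ ρ : MulChar (ZMod p) ℂ} (h : ¬ (χ = 1 ∧ ρ = 1)) :
    ‖∑ x : ZMod p, χ x * ρ (x * (x - 1) / (x - c))‖ ≤ 2 * Real.sqrt p := by
  let a : Fin 3 → ZMod p := ![0, 1, c]
  have ha : Function.Injective a := by
    intro i j hij
    fin_cases i <;> fin_cases j <;> simp_all [a, eq_comm]
  let φ : Fin 3 → MulChar (ZMod p) ℂ := ![χ * ρ, ρ, ρ⁻¹]
  have hφ : ∃ i, φ i ≠ 1 := by
    by_contra! h'
    have h1 : ρ = 1 := h' 1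
    have h0 : χ * ρ = 1 := h' 0
    rw [h1, mul_one] at h0
    exact h ⟨h0, h1⟩
  have key := norm_sum_prod_mulChar_sub_le (k := 2) rfl ha hφ
  have h1 : ∀ x : ZMod p, χ x * ρ (x * (x - 1) / (x - c)) =
      χ (-1) * ρ (-1) * ∏ i, φ i (a i - x) := by
    intro x
    simp only [Fin.prod_univ_three, φ, a, Matrix.cons_val_zero, Matrix.cons_val_one,
      Matrix.cons_val_two, Matrix.head_cons, Matrix.tail_cons, zero_sub,
      MulChar.mul_apply, MulChar.inv_apply']
    rw [show x * (x - 1) / (x - c) = -1 * (-x) * ((1 - x) * (c - x)⁻¹) * (-1) * (-1) by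
      rw [div_eq_mul_inv, ← neg_sub c x, inv_neg]; ring]
    rw [show χ x = χ (-1 * -x) by simp]
    have h2 : ρ (-1) * ρ (-1) = 1 := by rw [← map_mul]; simp
    simp only [map_mul]
    linear_combination (χ (-1) * χ (-x) * ρ (-1) * ρ (-x) * ρ (1 - x) * ρ (c - x)⁻¹) * h2
  simp only [h1]
  rw [← Finset.mul_sum, norm_mul, norm_mul, norm_mulChar_eq_one _ (neg_ne_zero.2 one_ne_zero),
    norm_mulChar_eq_one _ (neg_ne_zero.2 one_ne_zero), one_mul, one_mul]
  exact_mod_cast key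

theorem norm_sum_one_mulChar_sub_le {p : ℕ} [Fact p.Prime] (c : ZMod p) :
    ‖∑ x : ZMod p, (1 : MulChar (ZMod p) ℂ) x * (1 : MulChar (ZMod p) ℂ) (x * (x - 1) / (x - c)) -
      p‖ ≤ 3 := by
  classical
  have h : (p : ℂ) = ∑ x : ZMod p, 1 := by simp [ZMod.card]
  rw [h, ← Finset.sum_sub_distrib]
  rw [← Finset.sum_subset (Finset.subset_univ ({0, 1, c} : Finset (ZMod p)))]
  · refine (norm_sum_le_of_le (n := fun _ => 1) _ fun x _ => ?_).trans ?_
    · have h01 : ∀ z : ZMod p, (1 : MulChar (ZMod p) ℂ) z = 0 ∨ (1 : MulChar (ZMod p) ℂ) z = 1 :=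
        fun z => (em (IsUnit z)).symm.imp (MulChar.map_nonunit _) MulChar.one_apply
      rcases h01 x with h | h <;> rcases h01 (x * (x - 1) / (x - c)) with h' | h' <;>
        simp [h, h']
    · rw [Finset.sum_const, nsmul_eq_mul, mul_one]
      exact_mod_cast Finset.card_le_three
  · intro x _ hx
    simp only [Finset.mem_insert, Finset.mem_singleton, not_or] at hx
    have hg : x * (x - 1) / (x - c) ≠ 0 :=
      div_ne_zero (mul_ne_zero hx.1 (sub_ne_zero.2 hx.2.1)) (sub_ne_zero.2 hx.2.2)
    rw [MulChar.one_apply hg.isUnit, MulChar.one_apply (isUnit_iff_ne_zero.2 hx.1)]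
    simp

theorem sum_curve_mulChar_eq {p : ℕ} [Fact p.Prime] [DecidableEq (MulChar (ZMod p) ℂ)]
    (a b : (ZMod p)ˣ) (hab : a * b ≠ 1) (χ ψ : MulChar (ZMod p) ℂ) :
    ∑ y : (ZMod p)ˣ, ∑ t : (ZMod p)ˣ,
        (if (a : ZMod p) * t + b * (t⁻¹ : (ZMod p)ˣ) = y + (y⁻¹ : (ZMod p)ˣ) then χ t * ψ y else 0) =
      χ⁻¹ a * ∑ ρ : MulChar (ZMod p) ℂ, if ρ ^ 2 = ψ * χ⁻¹ then
        ∑ x : ZMod p, χ x * ρ (x * (x - 1) / (x - a * b)) else 0 := by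
  have h1 : ∀ y : (ZMod p)ˣ, ∑ t : (ZMod p)ˣ,
      (if (a : ZMod p) * t + b * (t⁻¹ : (ZMod p)ˣ) = y + (y⁻¹ : (ZMod p)ˣ) then χ t * ψ y else 0) =
      ∑ x : ZMod p, if (y : ZMod p) ^ 2 = x * (x - 1) / (x - a * b) then
        χ⁻¹ a * (χ x * (ψ * χ⁻¹) y) else 0 := by
    intro y
    refine Finset.sum_of_injOn (fun t => ((a * t * y : (ZMod p)ˣ) : ZMod p)) ?_ ?_ ?_ ?_
    · intro t _ t' _ h
      exact mul_left_cancel (mul_right_cancel (Units.val_injective h))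
    · exact fun _ _ => Finset.mem_coe.2 (Finset.mem_univ _)
    · intro x _ hx
      rcases eq_or_ne x 0 with rfl | hx0
      · simp
      · refine absurd ⟨a⁻¹ * Units.mk0 x hx0 * y⁻¹, Finset.mem_coe.2 (Finset.mem_univ _), ?_⟩ hx
        simp [mul_assoc]
    · intro t _
      have ht := t.ne_zero
      have hy := y.ne_zero
      have ha := a.ne_zero
      have hb := b.ne_zero
      have hab' : (a : ZMod p) * b ≠ 1 := fun h => hab (Units.ext (by simpa using h))
      have hiff : (a : ZMod p) * t + b * (t⁻¹ : (ZMod p)ˣ) = y + (y⁻¹ : (ZMod p)ˣ) ↔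
          (y : ZMod p) ^ 2 = (a * t * y) * ((a * t * y) - 1) / ((a * t * y) - a * b) := by
        have h2 : (a : ZMod p) * t + b * (t⁻¹ : (ZMod p)ˣ) = y + (y⁻¹ : (ZMod p)ˣ) ↔
            (y : ZMod p) ^ 2 * ((a * t * y) - a * b) = (a * t * y) * ((a * t * y) - 1) := by
          rw [Units.val_inv_eq_inv_val, Units.val_inv_eq_inv_val]
          field_simp
          constructor <;> intro h
          · linear_combination -h
          · linear_combination -h
        rw [h2]
        rcases eq_or_ne ((a : ZMod p) * t * y - a * b) 0 with h0 | h0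
        · rw [h0, mul_zero, div_zero]
          refine iff_of_false (fun h => ?_) (pow_ne_zero 2 hy)
          rcases mul_eq_zero.1 h.symm with h | h
          · exact mul_ne_zero (mul_ne_zero ha ht) hy h
          · exact hab' (by linear_combination h - h0)
        · rw [eq_div_iff h0]
      simp only [hiff, Units.val_mul]
      refine if_congr Iff.rfl ?_ rfl
      have e1 : χ⁻¹ a * χ a = 1 := by
        rw [← MulChar.mul_apply, inv_mul_cancel, MulChar.one_apply_coe]
      have e2 : χ⁻¹ y * χ y = 1 := by
        rw [← MulChar.mul_apply, inv_mul_cancel, MulChar.one_apply_coe]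
      rw [map_mul, map_mul, MulChar.mul_apply]
      linear_combination (-χ t * ψ y * χ y * χ⁻¹ y) * e1 - χ t * ψ y * e2
  simp only [h1]
  rw [Finset.sum_comm]
  simp only [← mul_ite_zero, ← Finset.mul_sum, sum_units_sq_eq_mulChar]
  congr 1
  simp only [Finset.mul_sum]
  rw [Finset.sum_comm]
  refine Finset.sum_congr rfl fun ρ _ => ?_
  split_ifs <;> simp

theorem norm_sum_curve_mulChar_sub_le {p : ℕ} [Fact p.Prime] [DecidableEq (MulChar (ZMod p) ℂ)]
    (a b : (ZMod p)ˣ) (hab : a * b ≠ 1) (χ ψ : MulChar (ZMod p) ℂ) :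
    ‖∑ y : (ZMod p)ˣ, ∑ t : (ZMod p)ˣ,
        (if (a : ZMod p) * t + b * (t⁻¹ : (ZMod p)ˣ) = y + (y⁻¹ : (ZMod p)ˣ) then χ t * ψ y else 0) -
      (if χ = 1 ∧ ψ = 1 then (p : ℂ) else 0)‖ ≤ 6 * Real.sqrt p := by
  have hab' : (a : ZMod p) * b ≠ 1 := fun h => hab (Units.ext (by simpa using h))
  have hp : 1 ≤ Real.sqrt p :=
    Real.one_le_sqrt.2 (by exact_mod_cast (Fact.out : p.Prime).one_le)
  have hmain : (if χ = 1 ∧ ψ = 1 then (p : ℂ) else 0) =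
      χ⁻¹ a * ∑ ρ : MulChar (ZMod p) ℂ, if ρ ^ 2 = ψ * χ⁻¹ then
        (if χ = 1 ∧ ρ = 1 then (p : ℂ) else 0) else 0 := by
    rw [Finset.sum_eq_single 1]
    · by_cases hχ : χ = 1
      · subst hχ
        simp [MulChar.one_apply_coe, eq_comm]
      · simp [hχ]
    · intro ρ _ hρ
      simp [hρ]
    · simp
  rw [sum_curve_mulChar_eq a b hab, hmain, ← mul_sub, ← Finset.sum_sub_distrib, norm_mul,
    norm_mulChar_eq_one _ a.ne_zero, one_mul]
  have hsub : ∀ (P : Prop) [Decidable P] (u v : ℂ),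
      (if P then u else 0) - (if P then v else 0) = if P then u - v else 0 := by
    intro P _ u v
    split_ifs <;> simp
  simp only [hsub]
  rw [← Finset.sum_filter]
  refine (norm_sum_le_of_le (n := fun _ => 3 * Real.sqrt p) _ fun ρ _ => ?_).trans ?_
  · split_ifs with h
    · rw [h.1, h.2]
      exact (norm_sum_one_mulChar_sub_le _).trans (by linarith)
    · rw [sub_zero]
      exact (norm_sum_mulChar_mul_mulChar_le (mul_ne_zero a.ne_zero b.ne_zero) hab' h).trans
        (by linarith)
  · rw [Finset.sum_const, nsmul_eq_mul]
    have : ((Finset.univ.filter fun ρ : MulChar (ZMod p) ℂ => ρ ^ 2 = ψ * χ⁻¹).card : ℝ) ≤ 2 := by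
      exact_mod_cast card_mulChar_sq_eq_le _
    nlinarith

end

theorem markoff_weil_count :
    ∃ C : ℝ, 0 < C ∧ ∀ p : ℕ, p.Prime → p ≠ 2 →
      ∀ a b : (ZMod p)ˣ, a * b ≠ 1 →
        ∀ H K : Subgroup (ZMod p)ˣ,
          |(({ty : (ZMod p)ˣ × (ZMod p)ˣ | ty.1 ∈ H ∧ ty.2 ∈ K ∧
              (a : ZMod p) * (ty.1 : ZMod p) + (b : ZMod p) * ((ty.1⁻¹ : (ZMod p)ˣ) : ZMod p) =
                (ty.2 : ZMod p) + ((ty.2⁻¹ : (ZMod p)ˣ) : ZMod p)}.ncard : ℝ)) -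
            (p : ℝ) * (Nat.card H) * (Nat.card K) / ((p : ℝ) - 1) ^ 2| ≤
          C * Real.sqrt p := by
  classical
  refine ⟨6, by norm_num, fun p hp _ a b hab H K => ?_⟩
  have : Fact p.Prime := ⟨hp⟩
  let D : MulChar (ZMod p) ℂ → MulChar (ZMod p) ℂ → ℂ := fun χ ψ =>
    ∑ y : (ZMod p)ˣ, ∑ t : (ZMod p)ˣ,
      if (a : ZMod p) * t + b * (t⁻¹ : (ZMod p)ˣ) = y + (y⁻¹ : (ZMod p)ˣ) then χ t * ψ y else 0
  have hcount : (({ty : (ZMod p)ˣ × (ZMod p)ˣ | ty.1 ∈ H ∧ ty.2 ∈ K ∧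
      (a : ZMod p) * (ty.1 : ZMod p) + (b : ZMod p) * ((ty.1⁻¹ : (ZMod p)ˣ) : ZMod p) =
        (ty.2 : ZMod p) + ((ty.2⁻¹ : (ZMod p)ˣ) : ZMod p)}.ncard : ℕ) : ℂ) =
      ∑ χ, ∑ ψ, (subgroupWeight H χ : ℂ) * subgroupWeight K ψ * D χ ψ := by
    rw [Set.ncard_eq_toFinset_card', Finset.card_eq_sum_ones, Set.toFinset_ofPred,
      Finset.sum_filter, Nat.cast_sum]
    trans ∑ y : (ZMod p)ˣ, ∑ t : (ZMod p)ˣ,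
        if (a : ZMod p) * t + b * (t⁻¹ : (ZMod p)ˣ) = y + (y⁻¹ : (ZMod p)ˣ) then
          (∑ χ : MulChar (ZMod p) ℂ, (subgroupWeight H χ : ℂ) * χ t) *
            ∑ ψ : MulChar (ZMod p) ℂ, (subgroupWeight K ψ : ℂ) * ψ y else 0
    · rw [Fintype.sum_prod_type, Finset.sum_comm]
      refine Finset.sum_congr rfl fun y _ => Finset.sum_congr rfl fun t _ => ?_
      rw [sum_subgroupWeight_mul, sum_subgroupWeight_mul]
      by_cases ht : t ∈ H <;> by_cases hy : y ∈ K <;>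
        simp only [ht, hy, true_and, false_and, if_true, if_false, mul_one, mul_zero, ite_self,
          Nat.cast_ite, Nat.cast_one, Nat.cast_zero]
    · have hdist : ∀ (P : Prop) [Decidable P] (t y : ZMod p),
          (if P then (∑ χ : MulChar (ZMod p) ℂ, (subgroupWeight H χ : ℂ) * χ t) *
            ∑ ψ : MulChar (ZMod p) ℂ, (subgroupWeight K ψ : ℂ) * ψ y else 0) =
          ∑ χ : MulChar (ZMod p) ℂ, ∑ ψ : MulChar (ZMod p) ℂ,
            (subgroupWeight H χ : ℂ) * subgroupWeight K ψ * if P then χ t * ψ y else 0 := by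
        intro P _ t y
        split_ifs
        · rw [Finset.sum_mul_sum]
          exact Finset.sum_congr rfl fun χ _ => Finset.sum_congr rfl fun ψ _ => by ring
        · simp
      simp only [hdist]
      simp only [D, Finset.mul_sum]
      simp_rw [Finset.sum_comm (s := (Finset.univ : Finset (ZMod p)ˣ))
        (t := (Finset.univ : Finset (MulChar (ZMod p) ℂ)))]
  have hmain : (((p : ℝ) * (Nat.card H) * (Nat.card K) / ((p : ℝ) - 1) ^ 2 : ℝ) : ℂ) =
      ∑ χ, ∑ ψ, (subgroupWeight H χ : ℂ) * subgroupWeight K ψ *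
        (if χ = 1 ∧ ψ = 1 then (p : ℂ) else 0) := by
    rw [Finset.sum_eq_single 1, Finset.sum_eq_single 1]
    · rw [subgroupWeight_one, subgroupWeight_one, if_pos ⟨rfl, rfl⟩]
      push_cast
      rw [div_eq_mul_inv, ← inv_pow]
      ring
    · intro ψ _ h
      simp [h]
    · simp
    · intro χ _ h
      simp [h]
    · simp
  rw [← Real.norm_eq_abs, ← Complex.norm_real, Complex.ofReal_sub, Complex.ofReal_natCast, hcount, hmain]
  simp only [← Finset.sum_sub_distrib, ← mul_sub]
  calc _ ≤ ∑ χ, ∑ ψ, subgroupWeight H χ * subgroupWeight K ψ * (6 * Real.sqrt p) := by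
        refine norm_sum_le_of_le _ fun χ _ => norm_sum_le_of_le _ fun ψ _ => ?_
        rw [norm_mul, norm_mul, Complex.norm_real, Complex.norm_real,
          Real.norm_of_nonneg (subgroupWeight_nonneg H χ),
          Real.norm_of_nonneg (subgroupWeight_nonneg K ψ)]
        exact mul_le_mul_of_nonneg_left (norm_sum_curve_mulChar_sub_le a b hab χ ψ)
          (mul_nonneg (subgroupWeight_nonneg H χ) (subgroupWeight_nonneg K ψ))
    _ = (∑ χ, subgroupWeight H χ) * (∑ ψ, subgroupWeight K ψ) * (6 * Real.sqrt p) := by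
        rw [Finset.sum_mul_sum]
        simp only [Finset.sum_mul]
    _ = 6 * Real.sqrt p := by
        rw [sum_subgroupWeight, sum_subgroupWeight, one_mul, one_mul]
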